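/- Let γ = (γ_j)_{j≥1} be a non-increasing sequence of weights with 1 ≥ γ_1 ≥ γ_2 ≥ … > 0 and let (p_j)_{j≥1} be a sequence of distinct primes such that Σ_{j=1}^∞ γ_j p_j²/log p_j < ∞. Then for every δ > 0 there exists a constant C = C(δ, γ, (p_j)) > 0, independent of the dimension s and of N, such that for all s ∈ ℕ and all N ≥ 2, the root mean square worst-case error satisfies ( ∫_{[0,1]^s} e²_{N,s}(H_{p,N} ⊕_p σ) dσ )^{1/2} ≤ C / N^{1−δ}, where p = (p_1,…,p_s). -/

import Mathlib

open MeasureTheory Finset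

/-- The digit of `x ∈ [0,1)` at base-`p` position `r` (the coefficient of `p^{-(r+1)}`),
using the finite expansion for `p`-adic rationals. -/
noncomputable def rdigit (p : ℕ) (x : ℝ) (r : ℕ) : ℕ :=
  (⌊x * (p : ℝ) ^ (r + 1)⌋).toNat % p

/-- The value of the `p`-adic integer `φ_p^+(x)` modulo `p^m`, as a natural number. -/
noncomputable def truncVal (p : ℕ) (x : ℝ) (m : ℕ) : ℕ :=
  ∑ r ∈ Finset.range m, rdigit p x r * p ^ r

/-- Digit `r` of the `p`-adic sum `φ_p^+(x) +_{ℤ_p} φ_p^+(σ)`. -/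
noncomputable def sdigit (p : ℕ) (x σ : ℝ) (r : ℕ) : ℕ :=
  (truncVal p x (r + 1) + truncVal p σ (r + 1)) % p ^ (r + 1) / p ^ r

/-- The `p`-adic shift `x ⊕_p σ = φ_p(φ_p^+(x) +_{ℤ_p} φ_p^+(σ))` (the Monna map applied to
the `p`-adic sum, taken mod 1). -/
noncomputable def pshift (p : ℕ) (x σ : ℝ) : ℝ :=
  Int.fract (∑' r : ℕ, (sdigit p x σ r : ℝ) / (p : ℝ) ^ (r + 1))

/-- The simplified `p`-adic shift `x ⊕_{p,m}^{simp} σ`: the truncation of `x ⊕_p σ` to its `m`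
most significant base-`p` digits. -/
noncomputable def simpShift (p m : ℕ) (x σ : ℝ) : ℝ :=
  ∑ r ∈ Finset.range m, (sdigit p x σ r : ℝ) / (p : ℝ) ^ (r + 1)

/-- The mid-simplified `p`-adic shift `x ⊕_{p,m}^{simi} σ = (x ⊕_{p,m}^{simp} σ) + 1/(2p^m)`. -/
noncomputable def midShift (p m : ℕ) (x σ : ℝ) : ℝ :=
  simpShift p m x σ + 1 / (2 * (p : ℝ) ^ m)

/-- The radical inverse function `φ_p(n) = Σ_r n_r p^{-(r+1)}` in base `p`. -/
noncomputable def radInv (p n : ℕ) : ℝ :=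
  ∑' r : ℕ, ((n / p ^ r % p : ℕ) : ℝ) / (p : ℝ) ^ (r + 1)

/-- Membership in `ℚ(p^m) = {a p^{-m} : a = 0,1,…,p^m - 1}`. -/
def QSet (p m : ℕ) (x : ℝ) : Prop :=
  ∃ a : ℕ, a < p ^ m ∧ x = (a : ℝ) / (p : ℝ) ^ m

/-- The squared worst-case error of the QMC rule based on the `N`-element point set
`P ⊆ [0,1)^d` in the weighted anchored Sobolev space with weights `γ` (0-indexed, so the
paper's `γ_j` is `γ (j-1)`). -/
noncomputable def sqErr (d N : ℕ) (γ : ℕ → ℝ) (P : Fin N → Fin d → ℝ) : ℝ :=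
  (∏ j : Fin d, (1 + γ j.val / 3))
    - 2 / (N : ℝ) * ∑ n : Fin N, ∏ j : Fin d, (1 + γ j.val / 2 * (1 - P n j ^ 2))
    + 1 / (N : ℝ) ^ 2 *
        ∑ n : Fin N, ∑ h : Fin N, ∏ j : Fin d, (1 + γ j.val * min (1 - P n j) (1 - P h j))


section digits

lemma rdigit_add_div_zero {p a : ℕ} (ha : a < p) {t : ℝ} (h0 : 0 ≤ t) (h1 : t < 1) :
    rdigit p ((a + t) / p) 0 = a := by
  have hp : (p : ℝ) ≠ 0 := by exact_mod_cast (by omega : p ≠ 0)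
  have : ((a : ℝ) + t) / p * (p : ℝ) ^ (0 + 1) = a + t := by field_simp; ring
  rw [rdigit, this]
  have h : ⌊(a : ℝ) + t⌋ = (a : ℤ) := by
    rw [Int.floor_eq_iff]; push_cast; constructor <;> linarith
  rw [h, Int.toNat_natCast, Nat.mod_eq_of_lt ha]

lemma rdigit_add_div_succ {p : ℕ} (hp0 : 0 < p) (a : ℕ) {t : ℝ} (h0 : 0 ≤ t) (r : ℕ) :
    rdigit p ((a + t) / p) (r + 1) = rdigit p t r := by
  have hp : (p : ℝ) ≠ 0 := by exact_mod_cast hp0.ne'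
  have : ((a : ℝ) + t) / p * (p : ℝ) ^ (r + 1 + 1) =
      ((p * (a * p ^ r) : ℕ) : ℤ) + t * (p : ℝ) ^ (r + 1) := by
    push_cast; field_simp; ring
  have hf : 0 ≤ ⌊t * (p : ℝ) ^ (r + 1)⌋ := Int.floor_nonneg.2 (by positivity)
  rw [rdigit, rdigit, this, Int.floor_intCast_add, Int.toNat_add (by positivity) hf,
    Int.toNat_natCast, Nat.mul_add_mod]

lemma truncVal_add_div {p a : ℕ} (ha : a < p) {t : ℝ} (h0 : 0 ≤ t) (h1 : t < 1) (m : ℕ) :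
    truncVal p ((a + t) / p) (m + 1) = a + p * truncVal p t m := by
  rw [truncVal, Finset.sum_range_succ', truncVal, Finset.mul_sum, rdigit_add_div_zero ha h0 h1]
  rw [add_comm]
  congr 1
  · simp
  · refine Finset.sum_congr rfl fun r _ => ?_
    rw [rdigit_add_div_succ (by omega) a h0]; ring

lemma digit_div_le {p : ℕ} (hp : 0 < p) (d r : ℕ) :
    ((d % p : ℕ) : ℝ) / (p : ℝ) ^ (r + 1) ≤ ((p : ℝ) - 1) / p * (1 / p) ^ r := by
  have hp' : (0 : ℝ) < p := by exact_mod_cast hp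
  have h : ((d % p : ℕ) : ℝ) ≤ p - 1 := by
    have := Nat.mod_lt d hp
    have : ((d % p + 1 : ℕ) : ℝ) ≤ p := by exact_mod_cast this
    push_cast at this ⊢; linarith
  rw [show ((p : ℝ) - 1) / p * (1 / p) ^ r = (p - 1) / (p : ℝ) ^ (r + 1) by
    rw [one_div, inv_pow, pow_succ]; field_simp]
  gcongr

lemma hasSum_max_digits {p : ℕ} (hp : 2 ≤ p) :
    HasSum (fun r : ℕ => ((p : ℝ) - 1) / p * (1 / p) ^ r) 1 := by
  have hp' : (2 : ℝ) ≤ p := by exact_mod_cast hp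
  have h := (hasSum_geometric_of_lt_one (r := 1 / (p : ℝ)) (by positivity)
    (by rw [div_lt_one (by linarith)]; linarith)).mul_left (((p : ℝ) - 1) / p)
  have h1 : ((p : ℝ) - 1) / p ≠ 0 := (div_pos (by linarith) (by linarith)).ne'
  rwa [one_sub_div (by positivity), mul_inv_cancel₀ h1] at h

lemma summable_digits {p : ℕ} (hp : 2 ≤ p) (d : ℕ → ℕ) :
    Summable fun r : ℕ => ((d r % p : ℕ) : ℝ) / (p : ℝ) ^ (r + 1) :=
  Summable.of_nonneg_of_le (fun _ => by positivity) (fun r => digit_div_le (by omega) (d r) r)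
    (hasSum_max_digits hp).summable

lemma tsum_digits_le_one {p : ℕ} (hp : 2 ≤ p) (d : ℕ → ℕ) :
    ∑' r : ℕ, ((d r % p : ℕ) : ℝ) / (p : ℝ) ^ (r + 1) ≤ 1 := by
  rw [← (hasSum_max_digits hp).tsum_eq]
  exact (summable_digits hp d).tsum_le_tsum (fun r => digit_div_le (by omega) (d r) r)
    (hasSum_max_digits hp).summable

lemma tsum_digits_succ {p : ℕ} (hp : 2 ≤ p) (d : ℕ → ℕ) :
    ∑' r : ℕ, ((d r % p : ℕ) : ℝ) / (p : ℝ) ^ (r + 1) =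
      ((d 0 % p : ℕ) + ∑' r : ℕ, ((d (r + 1) % p : ℕ) : ℝ) / (p : ℝ) ^ (r + 1)) / p := by
  rw [(summable_digits hp d).tsum_eq_zero_add, add_div, ← tsum_div_const]
  congr 1
  · simp
  · refine tsum_congr fun r => ?_
    rw [div_div, ← pow_succ]

lemma radInv_eq {p : ℕ} (hp : 2 ≤ p) (n : ℕ) :
    radInv p n = ((n % p : ℕ) + radInv p (n / p)) / p := by
  rw [radInv, tsum_digits_succ hp, radInv]
  simp [pow_succ', Nat.div_div_eq_div_mul]

lemma radInv_nonneg (p n : ℕ) : 0 ≤ radInv p n := tsum_nonneg fun _ => by positivity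

lemma radInv_lt_one {p : ℕ} (hp : 2 ≤ p) (n : ℕ) : radInv p n < 1 := by
  induction n using Nat.strong_induction_on with
  | _ n ih =>
    rcases Nat.eq_zero_or_pos n with rfl | hn
    · simp [radInv]
    · have hlt := ih _ (Nat.div_lt_self hn hp)
      have hp' : (0 : ℝ) < p := by exact_mod_cast (by omega : 0 < p)
      rw [radInv_eq hp, div_lt_one hp']
      have : ((n % p + 1 : ℕ) : ℝ) ≤ p := by exact_mod_cast Nat.mod_lt n (by omega)
      push_cast at this ⊢; linarith

lemma truncVal_radInv {p : ℕ} (hp : 2 ≤ p) (m n : ℕ) :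
    truncVal p (radInv p n) m = n % p ^ m := by
  induction m generalizing n with
  | zero => simp [truncVal, Nat.mod_one]
  | succ m ih =>
    rw [radInv_eq hp, truncVal_add_div (Nat.mod_lt _ (by omega)) (radInv_nonneg _ _)
      (radInv_lt_one hp _), ih, pow_succ', Nat.mod_mul]

/-- The sum of the digit series of `n + φ_p^+(σ)`; it equals `φ_p(n) ⊕_p σ` unless it is `1`. -/
noncomputable def odometer (p n : ℕ) (σ : ℝ) : ℝ :=
  ∑' r : ℕ, (((n + truncVal p σ (r + 1)) / p ^ r % p : ℕ) : ℝ) / (p : ℝ) ^ (r + 1)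

lemma pshift_radInv {p : ℕ} (hp : 2 ≤ p) (n : ℕ) (σ : ℝ) :
    pshift p (radInv p n) σ = Int.fract (odometer p n σ) := by
  rw [pshift, odometer]
  congr 2
  ext r
  rw [sdigit, truncVal_radInv hp, Nat.mod_add_mod, pow_succ, Nat.mod_mul_right_div_self]

lemma odometer_nonneg (p n : ℕ) (σ : ℝ) : 0 ≤ odometer p n σ := tsum_nonneg fun _ => by positivity

lemma odometer_le_one {p : ℕ} (hp : 2 ≤ p) (n : ℕ) (σ : ℝ) : odometer p n σ ≤ 1 :=
  tsum_digits_le_one hp _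

lemma odometer_add_div {p a : ℕ} (hp : 2 ≤ p) (ha : a < p) (n : ℕ) {t : ℝ}
    (ht : t ∈ Set.Ico (0 : ℝ) 1) :
    odometer p n ((a + t) / p) =
      (((n + a) % p : ℕ) + odometer p ((n + a) / p) t) / p := by
  rw [odometer, tsum_digits_succ hp, odometer]
  congr 2
  · rw [truncVal_add_div ha ht.1 ht.2]
    simp [truncVal]
  · refine tsum_congr fun r => ?_
    rw [truncVal_add_div ha ht.1 ht.2, pow_succ' p r, ← Nat.div_div_eq_div_mul, ← add_assoc,
      Nat.add_mul_div_left _ _ (by omega)]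

lemma measurable_odometer {p : ℕ} (hp : 2 ≤ p) (n : ℕ) : Measurable (odometer p n) := by
  have htrunc : ∀ m, Measurable fun σ => truncVal p σ m := fun m => by
    refine Finset.measurable_fun_sum _ fun r _ => ?_
    have h : Measurable fun σ : ℝ => ⌊σ * (p : ℝ) ^ (r + 1)⌋ :=
      Int.measurable_floor.comp (measurable_id.mul_const _)
    exact (measurable_from_top (f := fun z : ℤ => z.toNat % p * p ^ r)).comp h
  refine measurable_of_tendsto_metrizable (f := fun k σ => ∑ r ∈ Finset.range k,
    (((n + truncVal p σ (r + 1)) / p ^ r % p : ℕ) : ℝ) / (p : ℝ) ^ (r + 1)) (fun k => ?_) ?_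
  · refine Finset.measurable_fun_sum _ fun r _ => ?_
    exact (measurable_from_top (f := fun z : ℕ =>
      (((n + z) / p ^ r % p : ℕ) : ℝ) / (p : ℝ) ^ (r + 1))).comp (htrunc (r + 1))
  · rw [tendsto_pi_nhds]
    intro σ
    exact (summable_digits hp _).hasSum.tendsto_sum_nat

end digits

section integrals

lemma integrableOn_Ico_of_bounded {f : ℝ → ℝ} (hf : Measurable f) {M : ℝ}
    (hM : ∀ t, |f t| ≤ M) : IntegrableOn f (Set.Ico 0 1) :=
  Measure.integrableOn_of_bounded (M := M) measure_Ico_lt_top.ne hf.aestronglyMeasurable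
    (Filter.Eventually.of_forall hM)

lemma setIntegral_Ico_split {p : ℕ} (hp : 0 < p) {f : ℝ → ℝ} (hf : Measurable f) {M : ℝ}
    (hM : ∀ t, |f t| ≤ M) :
    ∫ t in Set.Ico (0 : ℝ) 1, f t =
      1 / p * ∑ a ∈ Finset.range p, ∫ t in Set.Ico (0 : ℝ) 1, f ((a + t) / p) := by
  have hp' : (p : ℝ) ≠ 0 := by exact_mod_cast hp.ne'
  have key : ∀ g : ℝ → ℝ, ∫ t in Set.Ico (0 : ℝ) 1, g t = ∫ t in (0 : ℝ)..1, g t := fun g => by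
    rw [intervalIntegral.integral_of_le zero_le_one, integral_Ico_eq_integral_Ioc]
  have hint : ∀ a b : ℝ, IntervalIntegrable f volume a b := fun a b => by
    rw [intervalIntegrable_iff]
    exact Measure.integrableOn_of_bounded (M := M) (by simp)
      hf.aestronglyMeasurable (Filter.Eventually.of_forall hM)
  have h := intervalIntegral.sum_integral_adjacent_intervals (μ := volume) (f := f)
    (a := fun k : ℕ => (k : ℝ) / p) (n := p) (fun k _ => hint _ _)
  simp only [Nat.cast_zero, zero_div, div_self hp'] at h
  rw [key, ← h, Finset.mul_sum]
  refine Finset.sum_congr rfl fun a _ => ?_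
  rw [key]
  have := intervalIntegral.integral_comp_add_div (a := 0) (b := 1) f hp' ((a : ℝ) / p)
  simp only [add_div]
  rw [this, smul_eq_mul, zero_div, add_zero, ← mul_assoc, one_div_mul_cancel hp', one_mul]
  push_cast
  rw [add_div]

lemma eq_zero_of_contracting {u : ℕ → ℝ} {B : ℝ} (hB : ∀ n, |u n| ≤ B)
    (h : ∀ b, (∀ n, |u n| ≤ b) → ∀ n, |u n| ≤ b / 2) (n : ℕ) : u n = 0 := by
  have hk : ∀ k : ℕ, ∀ n, |u n| ≤ B / 2 ^ k := fun k => by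
    induction k with
    | zero => simpa using hB
    | succ k ih =>
      intro n
      rw [pow_succ, ← div_div]
      exact h _ ih n
  have hlim : Filter.Tendsto (fun k : ℕ => B / 2 ^ k) Filter.atTop (nhds 0) := by
    have := (tendsto_pow_atTop_nhds_zero_of_lt_one (r := (1 / 2 : ℝ)) (by norm_num)
      (by norm_num)).const_mul B
    simpa [div_eq_mul_inv] using this
  have := ge_of_tendsto' hlim fun k => hk k n
  exact abs_nonpos_iff.1 this

/-- A bounded sequence satisfying the homogeneous self-similarity relation of the odometer
vanishes. -/
lemma eq_zero_of_selfSimilar {p : ℕ} (hp : 2 ≤ p) {c : ℝ} (hc0 : 0 ≤ c) (hc : c ≤ 1 / 2)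
    {u : ℕ → ℝ} {B : ℝ} (hB : ∀ n, |u n| ≤ B)
    (h : ∀ n, u n = c * (1 / p * ∑ a ∈ Finset.range p, u ((n + a) / p))) (n : ℕ) : u n = 0 := by
  refine eq_zero_of_contracting hB (fun b hb n => ?_) n
  have hp' : (0 : ℝ) < p := by exact_mod_cast (by omega : 0 < p)
  have hb0 : 0 ≤ b := (abs_nonneg _).trans (hb 0)
  have h1 : |∑ a ∈ Finset.range p, u ((n + a) / p)| ≤ p * b := by
    refine (Finset.abs_sum_le_sum_abs _ _).trans ?_
    refine (Finset.sum_le_sum fun a _ => hb _).trans ?_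
    simp
  have h2 : |1 / (p : ℝ) * ∑ a ∈ Finset.range p, u ((n + a) / p)| ≤ b := by
    rw [abs_mul, abs_of_pos (by positivity), one_div, inv_mul_le_iff₀ hp']
    exact h1
  rw [h n, abs_mul, abs_of_nonneg hc0]
  nlinarith

lemma sum_range_add_mod {p : ℕ} (hp : 0 < p) (n : ℕ) (g : ℕ → ℝ) :
    ∑ a ∈ Finset.range p, g ((n + a) % p) = ∑ a ∈ Finset.range p, g a := by
  have hmaps : ∀ a ∈ Finset.range p, (n + a) % p ∈ Finset.range p := fun a _ =>
    Finset.mem_range.2 (Nat.mod_lt _ hp)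
  have hinj : Set.InjOn (fun a => (n + a) % p) (Finset.range p : Set ℕ) := by
    intro a ha b hb hab
    simp only [Finset.coe_range, Set.mem_Iio] at ha hb
    have : n + a ≡ n + b [MOD p] := hab
    exact (Nat.ModEq.add_left_cancel' n this).eq_of_lt_of_lt ha hb
  exact Finset.sum_nbij (fun a => (n + a) % p) hmaps hinj
    (Finset.surjOn_of_injOn_of_card_le _ hmaps hinj le_rfl) fun _ _ => rfl

lemma sum_range_cast (p : ℕ) : ∑ a ∈ Finset.range p, (a : ℝ) = p * (p - 1) / 2 := by
  induction p with
  | zero => simp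
  | succ p ih => rw [Finset.sum_range_succ, ih]; push_cast; ring

lemma sum_range_sq (p : ℕ) :
    ∑ a ∈ Finset.range p, (a : ℝ) ^ 2 = p * (p - 1) * (2 * p - 1) / 6 := by
  induction p with
  | zero => simp
  | succ p ih => rw [Finset.sum_range_succ, ih]; push_cast; ring

variable {p : ℕ}

lemma integrableOn_comp_odometer (hp : 2 ≤ p) {g : ℝ → ℝ → ℝ}
    (hg : Measurable (Function.uncurry g)) {M : ℝ}
    (hM : ∀ x ∈ Set.Icc (0 : ℝ) 1, ∀ y ∈ Set.Icc (0 : ℝ) 1, |g x y| ≤ M) (n h : ℕ) :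
    IntegrableOn (fun σ => g (odometer p n σ) (odometer p h σ)) (Set.Ico 0 1) :=
  integrableOn_Ico_of_bounded (M := M)
    (hg.comp ((measurable_odometer hp n).prodMk (measurable_odometer hp h)))
    fun _ => hM _ ⟨odometer_nonneg _ _ _, odometer_le_one hp _ _⟩ _
      ⟨odometer_nonneg _ _ _, odometer_le_one hp _ _⟩

lemma integral_comp_odometer (hp : 2 ≤ p) {g : ℝ → ℝ → ℝ}
    (hg : Measurable (Function.uncurry g)) {M : ℝ}
    (hM : ∀ x ∈ Set.Icc (0 : ℝ) 1, ∀ y ∈ Set.Icc (0 : ℝ) 1, |g x y| ≤ M) (n h : ℕ) :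
    ∫ σ in Set.Ico (0 : ℝ) 1, g (odometer p n σ) (odometer p h σ) =
      1 / p * ∑ a ∈ Finset.range p, ∫ t in Set.Ico (0 : ℝ) 1,
        g ((((n + a) % p : ℕ) + odometer p ((n + a) / p) t) / p)
          ((((h + a) % p : ℕ) + odometer p ((h + a) / p) t) / p) := by
  rw [setIntegral_Ico_split (p := p) (f := fun σ => g (odometer p n σ) (odometer p h σ))
    (by omega) (M := M) (hg.comp ((measurable_odometer hp n).prodMk (measurable_odometer hp h)))
    fun _ => hM _ ⟨odometer_nonneg _ _ _, odometer_le_one hp _ _⟩ _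
      ⟨odometer_nonneg _ _ _, odometer_le_one hp _ _⟩]
  congr 1
  refine Finset.sum_congr rfl fun a ha => setIntegral_congr_fun measurableSet_Ico fun t ht => ?_
  simp only [odometer_add_div hp (Finset.mem_range.1 ha) _ ht]

lemma integrableOn_odometer (hp : 2 ≤ p) (n : ℕ) :
    IntegrableOn (odometer p n) (Set.Ico 0 1) :=
  integrableOn_comp_odometer hp (g := fun x _ => x) measurable_fst (M := 1)
    (fun x hx _ _ => by rw [abs_of_nonneg hx.1]; exact hx.2) n n

lemma integrableOn_odometer_sq (hp : 2 ≤ p) (n : ℕ) :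
    IntegrableOn (fun σ => odometer p n σ ^ 2) (Set.Ico 0 1) :=
  integrableOn_comp_odometer hp (g := fun x _ => x ^ 2) (measurable_fst.pow_const 2) (M := 1)
    (fun x hx _ _ => by rw [abs_of_nonneg (by positivity)]; nlinarith [hx.1, hx.2]) n n

lemma abs_setIntegral_Ico_le {f : ℝ → ℝ} {M : ℝ} (hM : ∀ t, |f t| ≤ M) :
    |∫ t in Set.Ico (0 : ℝ) 1, f t| ≤ M := by
  have := norm_setIntegral_le_of_norm_le_const (μ := volume) (s := Set.Ico (0 : ℝ) 1) (f := f)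
    (C := M) measure_Ico_lt_top fun x _ => hM x
  simpa using this

lemma integral_odometer (hp : 2 ≤ p) (n : ℕ) :
    ∫ σ in Set.Ico (0 : ℝ) 1, odometer p n σ = 1 / 2 := by
  have hp' : (2 : ℝ) ≤ p := by exact_mod_cast hp
  have hbd : ∀ n t, |odometer p n t| ≤ 1 := fun n t => by
    rw [abs_of_nonneg (odometer_nonneg _ _ _)]; exact odometer_le_one hp _ _
  have hrec : ∀ n, ∫ σ in Set.Ico (0 : ℝ) 1, odometer p n σ = 1 / p * ∑ a ∈ Finset.range p,
      ((((n + a) % p : ℕ) : ℝ) + ∫ σ in Set.Ico (0 : ℝ) 1, odometer p ((n + a) / p) σ) / p := by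
    intro n
    rw [integral_comp_odometer hp (g := fun x _ => x) measurable_fst (M := 1)
      (fun x hx _ _ => by rw [abs_of_nonneg hx.1]; exact hx.2) n n]
    congr 1
    refine Finset.sum_congr rfl fun a _ => ?_
    rw [integral_div, integral_add (by simp) (integrableOn_odometer hp _)]
    simp
  refine sub_eq_zero.1 (eq_zero_of_selfSimilar hp (c := 1 / p) (by positivity)
    (one_div_le_one_div_of_le (by norm_num) hp') (B := 2)
    (u := fun n => (∫ σ in Set.Ico (0 : ℝ) 1, odometer p n σ) - 1 / 2) (fun n => ?_)
    (fun n => ?_) n)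
  · have := abs_setIntegral_Ico_le (hbd n)
    rw [abs_le] at this ⊢
    constructor <;> linarith
  · rw [hrec n, ← Finset.sum_div, Finset.sum_add_distrib,
      sum_range_add_mod (by omega) n (fun a => (a : ℝ)), sum_range_cast, Finset.sum_sub_distrib]
    simp
    field_simp
    ring

lemma integral_odometer_sq (hp : 2 ≤ p) (n : ℕ) :
    ∫ σ in Set.Ico (0 : ℝ) 1, odometer p n σ ^ 2 = 1 / 3 := by
  have hp' : (2 : ℝ) ≤ p := by exact_mod_cast hp
  have hbd : ∀ n t, |odometer p n t ^ 2| ≤ 1 := fun n t => by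
    rw [abs_of_nonneg (by positivity)]
    nlinarith [odometer_nonneg p n t, odometer_le_one hp n t]
  have hrec : ∀ n, ∫ σ in Set.Ico (0 : ℝ) 1, odometer p n σ ^ 2 = 1 / p * ∑ a ∈ Finset.range p,
      ((((n + a) % p : ℕ) : ℝ) ^ 2 + (((n + a) % p : ℕ) : ℝ) +
        ∫ σ in Set.Ico (0 : ℝ) 1, odometer p ((n + a) / p) σ ^ 2) / p ^ 2 := by
    intro n
    rw [integral_comp_odometer hp (g := fun x _ => x ^ 2) (measurable_fst.pow_const 2) (M := 1)
      (fun x hx _ _ => by rw [abs_of_nonneg (by positivity)]; nlinarith [hx.1, hx.2]) n n]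
    congr 1
    refine Finset.sum_congr rfl fun a _ => ?_
    simp only [div_pow, add_sq]
    rw [integral_div, integral_add _ (integrableOn_odometer_sq hp _), integral_add (by simp)
      ((integrableOn_odometer hp _).const_mul _), integral_const_mul, integral_odometer hp]
    · simp
      ring
    · exact Integrable.add (by simp) ((integrableOn_odometer hp _).const_mul _)
  refine sub_eq_zero.1 (eq_zero_of_selfSimilar hp (c := 1 / p ^ 2) (by positivity)
    (one_div_le_one_div_of_le (by norm_num) (by nlinarith)) (B := 2)
    (u := fun n => (∫ σ in Set.Ico (0 : ℝ) 1, odometer p n σ ^ 2) - 1 / 3) (fun n => ?_)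
    (fun n => ?_) n)
  · have := abs_setIntegral_Ico_le (hbd n)
    rw [abs_le] at this ⊢
    constructor <;> linarith
  · rw [hrec n, ← Finset.sum_div, Finset.sum_add_distrib, Finset.sum_add_distrib,
      sum_range_add_mod (by omega) n (fun a => (a : ℝ)),
      sum_range_add_mod (by omega) n (fun a => (a : ℝ) ^ 2), sum_range_cast, sum_range_sq,
      Finset.sum_sub_distrib]
    simp
    field_simp
    ring

lemma ae_odometer_ne_one (hp : 2 ≤ p) (n : ℕ) :
    ∀ᵐ σ ∂(volume.restrict (Set.Ico (0 : ℝ) 1)), odometer p n σ ≠ 1 := by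
  classical
  have hp' : (2 : ℝ) ≤ p := by exact_mod_cast hp
  set g : ℝ → ℝ := fun x => if x = 1 then 1 else 0 with hg
  have hgm : Measurable g := Measurable.ite (measurableSet_singleton 1) measurable_const
    measurable_const
  have hgb : ∀ x, |g x| ≤ 1 := fun x => by simp only [hg]; split_ifs <;> simp
  have hg0 : ∀ x, 0 ≤ g x := fun x => by simp only [hg]; split_ifs <;> simp
  have hint : ∀ n, IntegrableOn (fun σ => g (odometer p n σ)) (Set.Ico 0 1) := fun n =>
    integrableOn_Ico_of_bounded (hgm.comp (measurable_odometer hp n)) fun t => hgb _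
  have hzero : ∫ σ in Set.Ico (0 : ℝ) 1, g (odometer p n σ) = 0 := by
    refine eq_zero_of_contracting (B := 1)
      (u := fun n => ∫ σ in Set.Ico (0 : ℝ) 1, g (odometer p n σ))
      (fun n => abs_setIntegral_Ico_le fun t => hgb _) (fun b hb n => ?_) n
    have hb0 : 0 ≤ b := (abs_nonneg _).trans (hb 0)
    rw [integral_comp_odometer hp (g := fun x _ => g x) (hgm.comp measurable_fst) (M := 1)
      (fun x _ _ _ => hgb x) n n]
    have hterm : ∀ a ∈ Finset.range p, |∫ t in Set.Ico (0 : ℝ) 1,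
        g ((((n + a) % p : ℕ) + odometer p ((n + a) / p) t) / p)| ≤
          (fun m : ℕ => if m = p - 1 then b else 0) ((n + a) % p) := by
      intro a _
      have hlt := Nat.mod_lt (n + a) (show 0 < p by omega)
      by_cases hm : (n + a) % p = p - 1
      · simp only [hm, if_true]
        refine le_of_eq_of_le ?_ (hb ((n + a) / p))
        congr 2
        ext t
        have : (((p - 1 : ℕ) : ℝ) + odometer p ((n + a) / p) t) / p = 1 ↔
            odometer p ((n + a) / p) t = 1 := by
          rw [div_eq_one_iff_eq (by linarith), Nat.cast_sub (by omega)]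
          push_cast
          constructor <;> intro h <;> linarith
        simp only [hg, this]
      · simp only [hm, if_false]
        have : ∀ t, g ((((n + a) % p : ℕ) + odometer p ((n + a) / p) t) / p) = 0 := by
          intro t
          have h1 : (((n + a) % p + 2 : ℕ) : ℝ) ≤ p := by exact_mod_cast (by omega)
          have h2 := odometer_le_one hp ((n + a) / p) t
          push_cast at h1
          have : (((n + a) % p : ℕ) + odometer p ((n + a) / p) t) / p ≠ 1 := by
            refine ne_of_lt ?_
            rw [div_lt_one (by linarith)]
            linarith
          simp only [hg, this, if_false]
        simp [this]
    rw [abs_mul, abs_of_nonneg (by positivity)]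
    have hsum : ∑ a ∈ Finset.range p, (fun m : ℕ => if m = p - 1 then b else 0) ((n + a) % p) =
        b := by
      refine (sum_range_add_mod (by omega) n fun m => if m = p - 1 then b else 0).trans ?_
      rw [Finset.sum_ite_eq' (Finset.range p), if_pos (Finset.mem_range.2 (by omega))]
    have h3 := (Finset.abs_sum_le_sum_abs _ _).trans ((Finset.sum_le_sum hterm).trans hsum.le)
    have h4 : 1 / (p : ℝ) ≤ 1 / 2 := one_div_le_one_div_of_le (by norm_num) hp'
    calc _ ≤ 1 / 2 * b := mul_le_mul h4 h3 (abs_nonneg _) (by norm_num)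
      _ = b / 2 := by ring
  rw [setIntegral_eq_zero_iff_of_nonneg_ae (Filter.Eventually.of_forall fun _ => hg0 _)
    (hint n)] at hzero
  filter_upwards [hzero] with σ hσ h1
  simp [hg, h1] at hσ

end integrals

section layers

/-- The `k`-th martingale difference, along the filtration of residues modulo `p ^ k`, of the
kernel `d ↦ 1/6 - ‖φ_p(· + d) - φ_p‖₁ / 2` on `ℤ_p`. -/
noncomputable def layer (p : ℕ) : ℕ → ℤ → ℝ
  | 0, d => 1 / 6 - ((d % p : ℤ) : ℝ) * (p - ((d % p : ℤ) : ℝ)) / (p : ℝ) ^ 2 -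
      if (p : ℤ) ∣ d then 1 / (6 * (p : ℝ)) else 0
  | k + 1, d => if (p : ℤ) ∣ d then layer p k (d / p) / p else 0

variable {p : ℕ}

lemma layer_eq_zero (hp : 0 < p) {k : ℕ} {d : ℤ} (h : ¬ ((p ^ k : ℕ) : ℤ) ∣ d) :
    layer p k d = 0 := by
  induction k generalizing d with
  | zero => simp at h
  | succ k ih =>
    rw [layer]
    split_ifs with hd
    · obtain ⟨e, rfl⟩ := hd
      rw [Int.mul_ediv_cancel_left _ (by exact_mod_cast hp.ne'), ih, zero_div]
      intro he
      refine h ?_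
      rw [pow_succ']
      push_cast at he ⊢
      exact mul_dvd_mul_left _ he
    · rfl

lemma abs_layer_le (hp : 2 ≤ p) (k : ℕ) (d : ℤ) : |layer p k d| ≤ 1 / (6 * (p : ℝ) ^ k) := by
  have hp' : (2 : ℝ) ≤ p := by exact_mod_cast hp
  induction k generalizing d with
  | zero =>
    rw [layer]
    have h0 : (0 : ℝ) ≤ ((d % p : ℤ) : ℝ) := by
      exact_mod_cast Int.emod_nonneg d (by omega)
    have h1 : ((d % p : ℤ) : ℝ) ≤ p := by
      exact_mod_cast (Int.emod_lt_of_pos d (by omega)).le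
    set c := ((d % p : ℤ) : ℝ)
    have h2 : c * (p - c) / (p : ℝ) ^ 2 ≤ 1 / 4 := by
      rw [div_le_iff₀ (by positivity)]
      nlinarith [sq_nonneg (p - 2 * c)]
    have h3 : 0 ≤ c * (p - c) / (p : ℝ) ^ 2 := by
      have : 0 ≤ p - c := by linarith
      positivity
    have h4 : 1 / (6 * (p : ℝ)) ≤ 1 / 12 := one_div_le_one_div_of_le (by norm_num) (by linarith)
    have h5 : 0 ≤ 1 / (6 * (p : ℝ)) := by positivity
    rw [abs_le]
    split_ifs with hd
    · have : c = 0 := by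
        have := Int.emod_eq_zero_of_dvd hd
        simp [c, this]
      simp only [this, zero_mul, zero_div]
      constructor <;> norm_num <;> norm_num at h4 h5 <;> linarith
    · constructor <;> norm_num <;> linarith
  | succ k ih =>
    rw [layer]
    split_ifs with hd
    · rw [abs_div, abs_of_pos (show (0 : ℝ) < p by linarith), div_le_iff₀ (by linarith)]
      refine (ih _).trans (le_of_eq ?_)
      rw [pow_succ]; field_simp
    · rw [abs_zero]; positivity

lemma layer_add (hp : 0 < p) (k : ℕ) (d t : ℤ) :
    layer p k (d + (p ^ (k + 1) : ℕ) * t) = layer p k d := by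
  induction k generalizing d with
  | zero =>
    simp only [layer, zero_add, pow_one, Int.add_mul_emod_self_left]
    congr 2
    simp
  | succ k ih =>
    have e : (((p ^ (k + 1 + 1) : ℕ) : ℤ)) * t = p * ((p ^ (k + 1) : ℕ) * t) := by
      push_cast; ring
    have h : (p : ℤ) ∣ d + (p ^ (k + 1 + 1) : ℕ) * t ↔ (p : ℤ) ∣ d :=
      dvd_add_left (e ▸ dvd_mul_right _ _)
    simp only [layer, h]
    rw [e, Int.add_mul_ediv_left _ _ (by omega), ih]

lemma sum_range_mul_dvd (hp : 0 < p) (q : ℕ) (g : ℤ → ℝ) :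
    ∑ d ∈ Finset.range (p * q), (if (p : ℤ) ∣ (d : ℤ) then g ((d : ℤ) / p) else 0) =
      ∑ e ∈ Finset.range q, g e := by
  induction q with
  | zero => simp
  | succ q ih =>
    rw [Nat.mul_succ, Finset.sum_range_add, ih, Finset.sum_range_succ]
    congr 1
    rw [Finset.sum_eq_single_of_mem 0 (Finset.mem_range.2 hp)]
    · have : (p : ℤ) ≠ 0 := by omega
      simp only [add_zero, Nat.cast_mul, dvd_mul_right, if_true]
      rw [Int.mul_ediv_cancel_left _ this]
    · intro a ha ha0
      rw [if_neg]
      push_cast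
      rw [dvd_add_right (dvd_mul_right _ _)]
      intro h
      have := Nat.le_of_dvd (by omega) (Int.natCast_dvd_natCast.1 h)
      have := Finset.mem_range.1 ha
      omega

lemma sum_layer (hp : 0 < p) (k : ℕ) :
    ∑ d ∈ Finset.range (p ^ (k + 1)), layer p k d = 0 := by
  have hp' : (p : ℝ) ≠ 0 := by exact_mod_cast hp.ne'
  induction k with
  | zero =>
    have h1 : ∀ d ∈ Finset.range (p ^ (0 + 1)), layer p 0 d =
        1 / 6 - (d : ℝ) * (1 / p) + (d : ℝ) ^ 2 * (1 / (p : ℝ) ^ 2) -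
          if d = 0 then 1 / (6 * (p : ℝ)) else 0 := by
      intro d hd
      rw [zero_add, pow_one, Finset.mem_range] at hd
      rw [layer, Int.emod_eq_of_lt (by omega) (by omega)]
      have : p ∣ d ↔ d = 0 := ⟨fun h => Nat.eq_zero_of_dvd_of_lt h hd, fun h => h ▸ dvd_zero _⟩
      simp only [Int.natCast_dvd_natCast, this]
      push_cast
      field_simp
      ring
    rw [Finset.sum_congr rfl h1, zero_add, pow_one, Finset.sum_sub_distrib,
      Finset.sum_add_distrib, Finset.sum_sub_distrib, ← Finset.sum_mul, ← Finset.sum_mul,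
      sum_range_cast, sum_range_sq, Finset.sum_ite_eq' , if_pos (Finset.mem_range.2 hp)]
    simp
    field_simp
    ring
  | succ k ih =>
    rw [pow_succ']
    simp only [layer]
    rw [sum_range_mul_dvd hp _ fun e => layer p k e / p, ← Finset.sum_div, ih, zero_div]

lemma sum_abs_add_mod_sub {c : ℕ} (hc : c < p) :
    ∑ b ∈ Finset.range p, |(((b + c) % p : ℕ) : ℝ) - b| = 2 * c * (p - c) := by
  obtain ⟨e, rfl⟩ := Nat.exists_eq_add_of_lt hc
  rw [show c + e + 1 = (e + 1) + c by ring, Finset.sum_range_add]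
  have h1 : ∀ b ∈ Finset.range (e + 1), |(((b + c) % (e + 1 + c) : ℕ) : ℝ) - b| = c := by
    intro b hb
    rw [Finset.mem_range] at hb
    rw [Nat.mod_eq_of_lt (by omega)]
    push_cast
    rw [add_sub_cancel_left, abs_of_nonneg (by positivity)]
  have h2 : ∀ b ∈ Finset.range c,
      |(((e + 1 + b + c) % (e + 1 + c) : ℕ) : ℝ) - (e + 1 + b : ℕ)| = e + 1 := by
    intro b hb
    rw [Finset.mem_range] at hb
    rw [show e + 1 + b + c = b + (e + 1 + c) by ring, Nat.add_mod_right,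
      Nat.mod_eq_of_lt (by omega)]
    push_cast
    rw [show (b : ℝ) - (e + 1 + b) = -(e + 1) by ring, abs_neg, abs_of_nonneg (by positivity)]
  rw [Finset.sum_congr rfl h1, Finset.sum_congr rfl h2]
  simp
  ring

lemma sum_abs_mod_sub_mod (hp : 0 < p) (n h : ℕ) :
    ∑ a ∈ Finset.range p, |(((n + a) % p : ℕ) : ℝ) - ((h + a) % p : ℕ)| =
      2 * ((((n : ℤ) - h) % p : ℤ) : ℝ) * (p - ((((n : ℤ) - h) % p : ℤ) : ℝ)) := by
  obtain ⟨c, hc⟩ := Int.eq_ofNat_of_zero_le (Int.emod_nonneg ((n : ℤ) - h) (b := p) (by omega))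
  have hlt : c < p := by
    have := Int.emod_lt_of_pos ((n : ℤ) - h) (b := p) (by omega)
    omega
  rw [hc]
  have : ∀ a ∈ Finset.range p, |(((n + a) % p : ℕ) : ℝ) - ((h + a) % p : ℕ)| =
      (fun b : ℕ => |(((b + c) % p : ℕ) : ℝ) - b|) ((h + a) % p) := by
    intro a _
    have : (n + a) % p = ((h + a) % p + c) % p := by
      zify
      rw [Int.emod_add_emod]
      rw [← hc, Int.add_emod_emod]
      congr 1
      ring
    simp only [this]
  rw [Finset.sum_congr rfl this, sum_range_add_mod hp h fun b : ℕ => |(((b + c) % p : ℕ) : ℝ) - b|,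
    sum_abs_add_mod_sub hlt]
  simp

lemma integral_abs_odometer_sub_rec (hp : 2 ≤ p) (n h : ℕ) :
    ∫ σ in Set.Ico (0 : ℝ) 1, |odometer p n σ - odometer p h σ| =
      1 / p * ∑ a ∈ Finset.range p, ∫ t in Set.Ico (0 : ℝ) 1,
        |(((n + a) % p : ℕ) + odometer p ((n + a) / p) t) / p -
          (((h + a) % p : ℕ) + odometer p ((h + a) / p) t) / p| :=
  integral_comp_odometer hp (g := fun x y => |x - y|)
    (continuous_fst.sub continuous_snd).abs.measurable (M := 1)
    (fun x hx y hy => by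
      rw [abs_abs, abs_le]; constructor <;> linarith [hx.1, hx.2, hy.1, hy.2]) n h

lemma integral_abs_odometer_sub (hp : 2 ≤ p) (m n h : ℕ) (hm : |(n : ℤ) - h| < (p ^ m : ℕ)) :
    1 / 6 - (∫ σ in Set.Ico (0 : ℝ) 1, |odometer p n σ - odometer p h σ|) / 2 =
      ∑ k ∈ Finset.range m, layer p k ((n : ℤ) - h) +
        if (n : ℤ) - h = 0 then 1 / (6 * (p : ℝ) ^ m) else 0 := by
  have hp0 : (0 : ℝ) < p := by exact_mod_cast (by omega : 0 < p)
  have hpz : (p : ℤ) ≠ 0 := by omega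
  induction m generalizing n h with
  | zero =>
    have : n = h := by
      rw [pow_zero, Nat.cast_one, Int.abs_lt_one_iff] at hm
      omega
    subst this
    simp
  | succ m ih =>
    rw [integral_abs_odometer_sub_rec hp, Finset.sum_range_succ']
    simp only [layer]
    by_cases hd : (p : ℤ) ∣ (n : ℤ) - h
    · have hmod : ∀ a, (n + a) % p = (h + a) % p := fun a => by
        have : h + a ≡ n + a [MOD p] := by
          rw [Nat.modEq_iff_dvd]; push_cast; simpa using hd
        exact this.symm
      have hdiv : ∀ a, (((n + a) / p : ℕ) : ℤ) - ((h + a) / p : ℕ) = ((n : ℤ) - h) / p := by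
        intro a
        have e1 := Nat.div_add_mod (n + a) p
        have e2 := Nat.div_add_mod (h + a) p
        rw [hmod a] at e1
        zify at e1 e2
        symm
        apply Int.ediv_eq_of_eq_mul_right hpz
        push_cast
        linarith
      obtain ⟨e, he⟩ := hd
      have hee : ((n : ℤ) - h) / p = e := by rw [he, Int.mul_ediv_cancel_left _ hpz]
      have hlt : |e| < (p ^ m : ℕ) := by
        rw [he, abs_mul, pow_succ', Nat.abs_cast] at hm
        push_cast at hm ⊢
        exact lt_of_mul_lt_mul_left hm (by omega)
      have hI : ∀ a ∈ Finset.range p, ∫ t in Set.Ico (0 : ℝ) 1,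
          |(((n + a) % p : ℕ) + odometer p ((n + a) / p) t) / p -
          (((h + a) % p : ℕ) + odometer p ((h + a) / p) t) / p| =
          2 * (1 / 6 - (∑ k ∈ Finset.range m, layer p k e +
            if e = 0 then 1 / (6 * (p : ℝ) ^ m) else 0)) / p := by
        intro a _
        have := ih ((n + a) / p) ((h + a) / p) (by rw [hdiv, hee]; exact hlt)
        rw [hdiv, hee] at this
        rw [← this]
        simp only [hmod a, ← sub_div, add_sub_add_left_eq_sub, abs_div, abs_of_pos hp0]
        rw [integral_div]
        ring
      have hmod0 : ((n : ℤ) - h) % p = 0 := Int.emod_eq_zero_of_dvd ⟨e, he⟩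
      have hdvd : (p : ℤ) ∣ (n : ℤ) - h := ⟨e, he⟩
      have hzero : (n : ℤ) - h = 0 ↔ e = 0 := by
        rw [he, mul_eq_zero]; simp only [hpz, false_or]
      rw [Finset.sum_congr rfl hI, Finset.sum_const, Finset.card_range, nsmul_eq_mul]
      simp only [hmod0, hdvd, hee, if_true, ← Finset.sum_div, hzero]
      split_ifs <;> simp <;> field_simp <;> ring
    · have hn0 : (n : ℤ) - h ≠ 0 := fun h0 => hd (h0 ▸ dvd_zero _)
      have hI : ∀ a ∈ Finset.range p, ∫ t in Set.Ico (0 : ℝ) 1,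
          |(((n + a) % p : ℕ) + odometer p ((n + a) / p) t) / p -
          (((h + a) % p : ℕ) + odometer p ((h + a) / p) t) / p| =
          |(((n + a) % p : ℕ) : ℝ) - ((h + a) % p : ℕ)| / p := by
        intro a _
        have hne : (n + a) % p ≠ (h + a) % p := by
          intro h0
          apply hd
          have : h + a ≡ n + a [MOD p] := h0.symm
          rw [Nat.modEq_iff_dvd] at this
          push_cast at this
          simpa using this
        set b := (n + a) % p
        set b' := (h + a) % p
        have hint : IntegrableOn (fun t => odometer p ((n + a) / p) t -
            odometer p ((h + a) / p) t) (Set.Ico 0 1) :=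
            (integrableOn_odometer hp ((n + a) / p)).sub
          (integrableOn_odometer hp ((h + a) / p))
        have hint0 : ∫ t in Set.Ico (0 : ℝ) 1,
            (odometer p ((n + a) / p) t - odometer p ((h + a) / p) t) = 0 := by
          rw [integral_sub (integrableOn_odometer hp _) (integrableOn_odometer hp _),
            integral_odometer hp, integral_odometer hp, sub_self]
        have hrange : ∀ t, |odometer p ((n + a) / p) t - odometer p ((h + a) / p) t| ≤ 1 := by
          intro t
          rw [abs_le]
          constructor <;> linarith [odometer_nonneg p ((n + a) / p) t,
            odometer_le_one hp ((n + a) / p) t, odometer_nonneg p ((h + a) / p) t,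
            odometer_le_one hp ((h + a) / p) t]
        simp only [← sub_div, add_sub_add_comm, abs_div, abs_of_pos hp0]
        rw [integral_div]
        congr 1
        rcases lt_or_gt_of_ne hne with hlt | hlt
        · have hb : (b : ℝ) + 1 ≤ b' := by exact_mod_cast hlt
          rw [abs_of_nonpos (by linarith : (b : ℝ) - b' ≤ 0)]
          rw [setIntegral_congr_fun (g := fun t => -((b : ℝ) - b') -
            (odometer p ((n + a) / p) t - odometer p ((h + a) / p) t)) measurableSet_Ico]
          · rw [integral_sub (by simp) hint, hint0]; simp
          · intro t _
            have := abs_le.1 (hrange t)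
            simp only
            rw [abs_of_nonpos (by linarith)]
            ring
        · have hb : (b' : ℝ) + 1 ≤ b := by exact_mod_cast hlt
          rw [abs_of_nonneg (by linarith : 0 ≤ (b : ℝ) - b')]
          rw [setIntegral_congr_fun (g := fun t => ((b : ℝ) - b') +
            (odometer p ((n + a) / p) t - odometer p ((h + a) / p) t)) measurableSet_Ico]
          · rw [integral_add (by simp) hint, hint0]; simp
          · intro t _
            have := abs_le.1 (hrange t)
            simp only
            rw [abs_of_nonneg (by linarith)]
      rw [Finset.sum_congr rfl hI, ← Finset.sum_div, sum_abs_mod_sub_mod (by omega)]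
      simp only [hd, hn0, if_false]
      simp
      field_simp

lemma integrableOn_comp_pshift (hp : 2 ≤ p) {g : ℝ → ℝ → ℝ}
    (hg : Measurable (Function.uncurry g)) {M : ℝ}
    (hM : ∀ x ∈ Set.Icc (0 : ℝ) 1, ∀ y ∈ Set.Icc (0 : ℝ) 1, |g x y| ≤ M) (n h : ℕ) :
    IntegrableOn (fun σ => g (pshift p (radInv p n) σ) (pshift p (radInv p h) σ))
      (Set.Ico 0 1) := by
  simp only [pshift_radInv hp]
  exact integrableOn_Ico_of_bounded (M := M) (hg.comp ((measurable_odometer hp n).fract.prodMk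
    (measurable_odometer hp h).fract)) fun t => hM _ ⟨Int.fract_nonneg _, (Int.fract_lt_one _).le⟩ _
      ⟨Int.fract_nonneg _, (Int.fract_lt_one _).le⟩

lemma ae_pshift_radInv (hp : 2 ≤ p) (n : ℕ) :
    ∀ᵐ σ ∂(volume.restrict (Set.Ico (0 : ℝ) 1)), pshift p (radInv p n) σ = odometer p n σ := by
  filter_upwards [ae_odometer_ne_one hp n] with σ hσ
  rw [pshift_radInv hp, Int.fract_eq_self]
  exact ⟨odometer_nonneg _ _ _, lt_of_le_of_ne (odometer_le_one hp _ _) hσ⟩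

lemma integral_one_add_sq (hp : 2 ≤ p) (γ : ℝ) (n : ℕ) :
    ∫ σ in Set.Ico (0 : ℝ) 1, (1 + γ / 2 * (1 - pshift p (radInv p n) σ ^ 2)) = 1 + γ / 3 := by
  rw [integral_congr_ae (g := fun σ => (1 + γ / 2) - γ / 2 * odometer p n σ ^ 2)]
  · rw [integral_sub (by simp) ((integrableOn_odometer_sq hp n).const_mul _), integral_const_mul,
      integral_odometer_sq hp]
    simp
    ring
  · filter_upwards [ae_pshift_radInv hp n] with σ hσ
    rw [hσ]; ring

lemma integral_one_add_min (hp : 2 ≤ p) (γ : ℝ) (m n h : ℕ)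
    (hm : |(n : ℤ) - h| < (p ^ m : ℕ)) :
    ∫ σ in Set.Ico (0 : ℝ) 1, (1 + γ * min (1 - pshift p (radInv p n) σ)
      (1 - pshift p (radInv p h) σ)) =
      1 + γ / 3 + γ * ∑ k ∈ Finset.range m, layer p k ((n : ℤ) - h) +
        if (n : ℤ) - h = 0 then γ / (6 * (p : ℝ) ^ m) else 0 := by
  have hint : IntegrableOn (fun σ => |odometer p n σ - odometer p h σ|) (Set.Ico 0 1) :=
    ((integrableOn_odometer hp n).sub (integrableOn_odometer hp h)).abs
  rw [integral_congr_ae (g := fun σ => (1 + γ) - γ / 2 * odometer p n σ -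
    γ / 2 * odometer p h σ - γ / 2 * |odometer p n σ - odometer p h σ|)]
  · have h1 := (integrableOn_odometer hp n).const_mul (γ / 2)
    have h2 := (integrableOn_odometer hp h).const_mul (γ / 2)
    have h3 := hint.const_mul (γ / 2)
    have h0 : IntegrableOn (fun _ : ℝ => 1 + γ) (Set.Ico 0 1) := by simp
    have h4 : IntegrableOn (fun σ => (1 + γ) - γ / 2 * odometer p n σ) (Set.Ico 0 1) := h0.sub h1
    have h5 : IntegrableOn (fun σ => (1 + γ) - γ / 2 * odometer p n σ - γ / 2 * odometer p h σ)
      (Set.Ico 0 1) := h4.sub h2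
    rw [integral_sub h5 h3, integral_sub h4 h2, integral_sub h0 h1,
      integral_const_mul, integral_const_mul, integral_const_mul, integral_odometer hp,
      integral_odometer hp]
    have key := integral_abs_odometer_sub hp m n h hm
    have : (if (n : ℤ) - h = 0 then γ / (6 * (p : ℝ) ^ m) else 0) =
        γ * (if (n : ℤ) - h = 0 then 1 / (6 * (p : ℝ) ^ m) else 0) := by
      split_ifs <;> ring
    rw [this, add_assoc, ← mul_add, ← key]
    simp
    ring
  · filter_upwards [ae_pshift_radInv hp n, ae_pshift_radInv hp h] with σ h1 h2
    rw [h1, h2]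
    rcases le_total (odometer p n σ) (odometer p h σ) with hle | hle
    · rw [abs_of_nonpos (by linarith), min_eq_right (by linarith)]
      ring
    · rw [abs_of_nonneg (by linarith), min_eq_left (by linarith)]
      ring

end layers

section periodic

lemma sum_range_mul_eq (f : ℕ → ℝ) (q r : ℕ) :
    ∑ t ∈ Finset.range (q * r), f t =
      ∑ e ∈ Finset.range q, ∑ t ∈ Finset.range r, f (q * t + e) := by
  rw [Finset.sum_comm]
  induction r with
  | zero => simp
  | succ r ih => rw [Nat.mul_succ, Finset.sum_range_add, ih, Finset.sum_range_succ]

lemma sum_range_affine {q : ℕ} (hq : 0 < q) {G : ℤ → ℝ} (hG : ∀ d t, G (d + q * t) = G d)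
    {a : ℤ} (ha : IsCoprime (q : ℤ) a) (r : ℤ) :
    ∑ t ∈ Finset.range q, G (r + a * t) = ∑ t ∈ Finset.range q, G t := by
  have hmod : ∀ d : ℤ, G (d % q) = G d := fun d => by
    conv_rhs => rw [← Int.emod_add_mul_ediv d q]
    rw [hG]
  have hnn : ∀ d : ℤ, (((d % q).toNat : ℕ) : ℤ) = d % q := fun d =>
    Int.toNat_of_nonneg (Int.emod_nonneg _ (by omega))
  have hmaps : ∀ t ∈ Finset.range q, ((r + a * t) % q).toNat ∈ Finset.range q := fun t _ => by
    have := Int.emod_lt_of_pos (r + a * t) (b := q) (by omega)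
    rw [Finset.mem_range]
    zify
    rwa [hnn]
  have hinj : Set.InjOn (fun t : ℕ => ((r + a * t) % q).toNat) (Finset.range q : Set ℕ) := by
    intro t ht t' ht' h
    simp only [Finset.coe_range, Set.mem_Iio] at ht ht'
    have h1 : (r + a * t) % q = (r + a * t') % q := by
      rw [← hnn (r + a * t), ← hnn (r + a * t')]
      exact congrArg (fun z : ℕ => (z : ℤ)) h
    have h2 : (q : ℤ) ∣ a * (t' - t) := by
      have h3 : (q : ℤ) ∣ (r + a * t') - (r + a * t) := (Int.ModEq.dvd h1)
      convert h3 using 1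
      ring
    have h4 : (q : ℤ) ∣ (t' : ℤ) - t := ha.dvd_of_dvd_mul_left h2
    exact (Nat.modEq_iff_dvd.2 h4).eq_of_lt_of_lt ht ht'
  refine Finset.sum_nbij (fun t : ℕ => ((r + a * t) % q).toNat) hmaps hinj
    (Finset.surjOn_of_injOn_of_card_le _ hmaps hinj le_rfl) fun t _ => ?_
  rw [hnn, hmod]

lemma sum_range_affine_mod {q : ℕ} (hq : 0 < q) {F : ℤ → ℝ} (hF : ∀ d t, F (d + q * t) = F d)
    (hsum : ∑ t ∈ Finset.range q, F t = 0) {a : ℤ} (ha : IsCoprime (q : ℤ) a) (r : ℤ) (N : ℕ) :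
    ∑ t ∈ Finset.range N, F (r + a * t) = ∑ t ∈ Finset.range (N % q), F (r + a * t) := by
  have hshift : ∀ k : ℕ, ∀ t : ℕ, F (r + a * ((q * k + t : ℕ) : ℤ)) = F (r + a * t) := by
    intro k t
    rw [← hF (r + a * t) (a * k)]
    congr 1
    push_cast
    ring
  have hfull : ∀ k : ℕ, ∑ t ∈ Finset.range (q * k), F (r + a * t) = 0 := by
    intro k
    induction k with
    | zero => simp
    | succ k ih =>
      rw [Nat.mul_succ, Finset.sum_range_add, ih, zero_add]
      simp only [hshift]
      rw [sum_range_affine hq hF ha, hsum]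
  conv_lhs => rw [← Nat.div_add_mod N q]
  rw [Finset.sum_range_add, hfull, zero_add]
  simp only [hshift]

lemma abs_double_sum_le {M P : ℕ} (hM : 0 < M) (hP : 0 < P) {F : ℤ → ℝ}
    (hF : ∀ d t, F (d + (M * P : ℕ) * t) = F d) (hsum : ∑ t ∈ Finset.range (M * P), F t = 0)
    (hsupp : ∀ d, ¬ (M : ℤ) ∣ d → F d = 0) {B : ℝ} (hB : ∀ d, |F d| ≤ B) (N : ℕ) :
    |∑ n ∈ Finset.range N, ∑ h ∈ Finset.range N, F ((n : ℤ) - h)| ≤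
      B * M * ((min P N : ℕ) : ℝ) ^ 2 := by
  have hq : 0 < M * P := Nat.mul_pos hM hP
  have hB0 : 0 ≤ B := (abs_nonneg _).trans (hB 0)
  set R := N % (M * P) with hR
  have hRN : R ≤ N := Nat.mod_le _ _
  have hRq : R ≤ M * P := (Nat.mod_lt _ hq).le
  have hneg : ∀ n : ℤ, ∀ K : ℕ, ∑ h ∈ Finset.range K, F (n - h) =
      ∑ h ∈ Finset.range K, F (n + (-1) * h) := fun n K =>
    Finset.sum_congr rfl fun h _ => by congr 1; ring
  have hred : ∑ n ∈ Finset.range N, ∑ h ∈ Finset.range N, F ((n : ℤ) - h) =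
      ∑ n ∈ Finset.range R, ∑ h ∈ Finset.range R, F ((n : ℤ) - h) := by
    have h1 : ∀ n ∈ Finset.range N, ∑ h ∈ Finset.range N, F ((n : ℤ) - h) =
        ∑ h ∈ Finset.range R, F ((n : ℤ) - h) := fun n _ => by
      rw [hneg, hneg]
      exact sum_range_affine_mod hq hF hsum (isCoprime_one_right.neg_right) _ _
    rw [Finset.sum_congr rfl h1, Finset.sum_comm]
    conv_rhs => rw [Finset.sum_comm]
    refine Finset.sum_congr rfl fun h _ => ?_
    have h2 : ∀ K : ℕ, ∑ n ∈ Finset.range K, F ((n : ℤ) - h) =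
        ∑ n ∈ Finset.range K, F (-(h : ℤ) + 1 * n) := fun K =>
      Finset.sum_congr rfl fun n _ => by congr 1; ring
    rw [h2, h2]
    exact sum_range_affine_mod hq hF hsum isCoprime_one_right _ _
  have hrow : ∀ n : ℕ, ∑ h ∈ Finset.range R, |F ((n : ℤ) - h)| ≤ P * B := by
    intro n
    set G : ℤ → ℝ := fun d => if (M : ℤ) ∣ d then B else 0 with hG
    have hGF : ∀ d, |F d| ≤ G d := by
      intro d
      simp only [hG]
      split_ifs with hd
      · exact hB d
      · rw [hsupp d hd, abs_zero]
    have hG0 : ∀ d, 0 ≤ G d := fun d => (abs_nonneg _).trans (hGF d)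
    have hGp : ∀ d t, G (d + (M * P : ℕ) * t) = G d := by
      intro d t
      have : (M : ℤ) ∣ d + (M * P : ℕ) * t ↔ (M : ℤ) ∣ d := by
        apply dvd_add_left
        push_cast
        exact ⟨P * t, by ring⟩
      simp only [hG, this]
    calc ∑ h ∈ Finset.range R, |F ((n : ℤ) - h)|
        ≤ ∑ h ∈ Finset.range R, G ((n : ℤ) + (-1) * h) := Finset.sum_le_sum fun h _ => by
          rw [show (n : ℤ) + (-1) * h = n - h by ring]; exact hGF _
      _ ≤ ∑ h ∈ Finset.range (M * P), G ((n : ℤ) + (-1) * h) :=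
          Finset.sum_le_sum_of_subset_of_nonneg (Finset.range_mono hRq) fun _ _ _ => hG0 _
      _ = ∑ h ∈ Finset.range (M * P), G h :=
          sum_range_affine hq hGp (isCoprime_one_right.neg_right) _
      _ = P * B := by
          have := sum_range_mul_dvd hM P fun _ => B
          simp only [hG, this]
          simp
  have htri : |∑ n ∈ Finset.range R, ∑ h ∈ Finset.range R, F ((n : ℤ) - h)| ≤
      ∑ n ∈ Finset.range R, ∑ h ∈ Finset.range R, |F ((n : ℤ) - h)| :=
    (Finset.abs_sum_le_sum_abs _ _).trans (Finset.sum_le_sum fun _ _ =>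
      Finset.abs_sum_le_sum_abs _ _)
  rw [hred]
  refine htri.trans ?_
  have hM1 : (1 : ℝ) ≤ M := by exact_mod_cast hM
  rcases le_total P N with h | h
  · rw [min_eq_left h]
    refine (Finset.sum_le_sum fun n _ => hrow n).trans ?_
    rw [Finset.sum_const, Finset.card_range, nsmul_eq_mul]
    have : (R : ℝ) ≤ M * P := by exact_mod_cast hRq
    calc (R : ℝ) * (P * B) ≤ M * P * (P * B) := by gcongr
      _ = _ := by ring
  · rw [min_eq_right h]
    refine (Finset.sum_le_sum fun n _ => Finset.sum_le_sum fun h _ => hB _).trans ?_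
    simp only [Finset.sum_const, Finset.card_range, nsmul_eq_mul]
    have : (R : ℝ) ≤ N := by exact_mod_cast hRN
    calc (R : ℝ) * (R * B) ≤ N * (N * B) := by gcongr
      _ = B * 1 * (N : ℝ) ^ 2 := by ring
      _ ≤ _ := by gcongr

lemma min_prod_le {ι : Type*} [DecidableEq ι] (P : ι → ℕ) (u : Finset ι) {N : ℕ} (hN : 0 < N) :
    min (∏ i ∈ u, P i) N ≤ ∏ i ∈ u, min (P i) N := by
  induction u using Finset.induction_on with
  | empty => simp
  | insert i u hi ih =>
    rw [Finset.prod_insert hi, Finset.prod_insert hi]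
    refine le_trans ?_ (Nat.mul_le_mul_left _ ih)
    rcases le_total (P i) N with h | h
    · rw [min_eq_left h]
      rcases Nat.eq_zero_or_pos (P i) with h0 | h0
      · simp [h0]
      · rw [← Nat.mul_min_mul_left]
        exact min_le_min_left _ (Nat.le_mul_of_pos_left _ h0)
    · rw [min_eq_right h]
      rcases Nat.eq_zero_or_pos (∏ j ∈ u, P j) with h0 | h0
      · simp [h0]
      · exact (min_le_right _ _).trans (Nat.le_mul_of_pos_right _ (lt_min h0 hN))

variable {ι : Type*} [Fintype ι] [DecidableEq ι]

lemma sum_prod_eq_zero {q : ι → ℕ} (hq : ∀ i, 0 < q i)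
    (hcop : Pairwise fun i j => Nat.Coprime (q i) (q j)) {G : ι → ℤ → ℝ}
    (hG : ∀ i d t, G i (d + q i * t) = G i d) {i₀ : ι}
    (hzero : ∑ t ∈ Finset.range (q i₀), G i₀ t = 0) :
    ∑ t ∈ Finset.range (∏ i, q i), ∏ i, G i t = 0 := by
  rw [← Finset.prod_erase_mul Finset.univ q (Finset.mem_univ i₀), sum_range_mul_eq]
  set Q := ∏ i ∈ Finset.univ.erase i₀, q i with hQ
  refine Finset.sum_eq_zero fun e _ => ?_
  have hcopQ : IsCoprime ((q i₀ : ℕ) : ℤ) (Q : ℤ) := by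
    rw [Nat.isCoprime_iff_coprime, hQ]
    exact Nat.Coprime.prod_right fun i hi => hcop (Finset.ne_of_mem_erase hi).symm
  have hterm : ∀ t : ℕ, ∏ i, G i ((Q * t + e : ℕ) : ℤ) =
      (∏ i ∈ Finset.univ.erase i₀, G i e) * G i₀ ((e : ℤ) + Q * t) := by
    intro t
    rw [← Finset.prod_erase_mul Finset.univ _ (Finset.mem_univ i₀)]
    congr 1
    · refine Finset.prod_congr rfl fun i hi => ?_
      obtain ⟨c, hc⟩ := Finset.dvd_prod_of_mem q hi
      rw [← hG i e (c * t)]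
      congr 1
      rw [hQ, hc]
      push_cast
      ring
    · congr 1
      push_cast
      ring
  simp only [hterm]
  rw [← Finset.mul_sum, sum_range_affine (hq i₀) (hG i₀) hcopQ, hzero, mul_zero]

/-- The terms of the layer expansion of `A + γ * ∑ k, layer p k`. -/
noncomputable def layerTerm (A γ : ℝ) (p : ℕ) : ℕ → ℤ → ℝ
  | 0, _ => A
  | k + 1, d => γ * layer p k d

/-- An upper bound for the contribution of `layerTerm` to the double sum over an `N`-element
range. -/
noncomputable def layerBound (A γ : ℝ) (p N : ℕ) : ℕ → ℝ
  | 0 => A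
  | _ + 1 => γ / 6 * ((min p N : ℕ) : ℝ) ^ 2

lemma layerBound_nonneg {A γ : ℝ} (hA : 0 ≤ A) (hγ : 0 ≤ γ) (p N k : ℕ) :
    0 ≤ layerBound A γ p N k := by
  cases k <;> simp only [layerBound] <;> positivity

lemma abs_double_sum_prod_layerTerm_le {p : ι → ℕ} (hp : ∀ i, (p i).Prime)
    (hinj : Function.Injective p) {A γ : ι → ℝ} (hA : ∀ i, 0 ≤ A i) (hγ : ∀ i, 0 ≤ γ i)
    {κ : ι → ℕ} (hκ : κ ≠ 0) {N : ℕ} (hN : 0 < N) :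
    |∑ n ∈ Finset.range N, ∑ h ∈ Finset.range N,
      ∏ i, layerTerm (A i) (γ i) (p i) (κ i) ((n : ℤ) - h)| ≤
      ∏ i, layerBound (A i) (γ i) (p i) N (κ i) := by
  set M : ι → ℕ := fun i => p i ^ (κ i - 1) with hM
  set P : ι → ℕ := fun i => if κ i = 0 then 1 else p i with hP
  set B : ι → ℝ := fun i =>
    if κ i = 0 then A i else γ i * (1 / (6 * (p i : ℝ) ^ (κ i - 1))) with hBdef
  have hp0 : ∀ i, 0 < p i := fun i => (hp i).pos
  have hM0 : ∀ i, 0 < M i := fun i => pow_pos (hp0 i) _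
  have hP0 : ∀ i, 0 < P i := fun i => by
    simp only [hP]; split_ifs; exacts [one_pos, hp0 i]
  have hMP : ∀ i, M i * P i = p i ^ κ i := fun i => by
    simp only [hM, hP]
    split_ifs with h
    · simp [h]
    · rw [← pow_succ]; congr 1; omega
  have hper : ∀ i d t, layerTerm (A i) (γ i) (p i) (κ i) (d + (M i * P i : ℕ) * t) =
      layerTerm (A i) (γ i) (p i) (κ i) d := by
    intro i d t
    rw [hMP]
    rcases κ i with _ | k
    · rfl
    · simp only [layerTerm, layer_add (hp0 i)]
  have hsupp : ∀ i d, ¬ (M i : ℤ) ∣ d → layerTerm (A i) (γ i) (p i) (κ i) d = 0 := by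
    intro i d hd
    simp only [hM] at hd
    rcases hk : κ i with _ | k
    · simp [hk] at hd
    · rw [hk, Nat.add_sub_cancel] at hd
      simp only [layerTerm, layer_eq_zero (hp0 i) hd, mul_zero]
  have hbd : ∀ i d, |layerTerm (A i) (γ i) (p i) (κ i) d| ≤ B i := by
    intro i d
    simp only [hBdef]
    rcases κ i with _ | k
    · simp [layerTerm, abs_of_nonneg (hA i)]
    · simp only [layerTerm, abs_mul, abs_of_nonneg (hγ i), Nat.add_sub_cancel,
        Nat.add_eq_zero_iff, one_ne_zero, and_false, if_false]
      exact mul_le_mul_of_nonneg_left (abs_layer_le (hp i).two_le k d) (hγ i)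
  obtain ⟨i₀, hi₀⟩ := Function.ne_iff.1 hκ
  have hzero : ∑ t ∈ Finset.range (M i₀ * P i₀),
      layerTerm (A i₀) (γ i₀) (p i₀) (κ i₀) t = 0 := by
    rw [hMP]
    obtain ⟨k, hk⟩ := Nat.exists_eq_succ_of_ne_zero hi₀
    rw [hk]
    simp only [layerTerm, Nat.succ_eq_add_one]
    rw [← Finset.mul_sum, sum_layer (hp0 i₀), mul_zero]
  have hcop : Pairwise fun i j => Nat.Coprime (M i * P i) (M j * P j) := by
    intro i j hij
    simp only [hMP]
    exact Nat.Coprime.pow _ _ ((Nat.coprime_primes (hp i) (hp j)).2 fun h => hij (hinj h))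
  have hsum := sum_prod_eq_zero (q := fun i => M i * P i) (fun i => Nat.mul_pos (hM0 i) (hP0 i))
    hcop (G := fun i => layerTerm (A i) (γ i) (p i) (κ i)) hper hzero
  rw [Finset.prod_mul_distrib] at hsum
  have hmain := abs_double_sum_le (M := ∏ i, M i) (P := ∏ i, P i)
    (Finset.prod_pos fun i _ => hM0 i) (Finset.prod_pos fun i _ => hP0 i)
    (F := fun d => ∏ i, layerTerm (A i) (γ i) (p i) (κ i) d) (B := ∏ i, B i) ?_ hsum ?_ ?_ N
  · refine hmain.trans ?_
    have hmin : ((min (∏ i, P i) N : ℕ) : ℝ) ≤ ∏ i, ((min (P i) N : ℕ) : ℝ) := by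
      exact_mod_cast min_prod_le P Finset.univ hN
    have hB0 : 0 ≤ ∏ i, B i := Finset.prod_nonneg fun i _ => (abs_nonneg _).trans (hbd i 0)
    calc (∏ i, B i) * ((∏ i, M i : ℕ) : ℝ) * ((min (∏ i, P i) N : ℕ) : ℝ) ^ 2
        ≤ (∏ i, B i) * ((∏ i, M i : ℕ) : ℝ) * (∏ i, ((min (P i) N : ℕ) : ℝ)) ^ 2 := by gcongr
      _ = ∏ i, (B i * M i * ((min (P i) N : ℕ) : ℝ) ^ 2) := by
          rw [Finset.prod_mul_distrib, Finset.prod_mul_distrib, Finset.prod_pow]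
          push_cast
          rfl
      _ = _ := by
          refine Finset.prod_congr rfl fun i _ => ?_
          have hpi : (p i : ℝ) ≠ 0 := by exact_mod_cast (hp0 i).ne'
          simp only [hBdef, hM, hP]
          rcases κ i with _ | k
          · simp [layerBound, Nat.one_le_iff_ne_zero.2 hN.ne']
          · simp only [layerBound, Nat.add_sub_cancel, Nat.add_eq_zero_iff, one_ne_zero, and_false,
              if_false]
            push_cast
            field_simp
  · intro d t
    refine Finset.prod_congr rfl fun i _ => ?_
    obtain ⟨c, hc⟩ := Finset.dvd_prod_of_mem (fun i => M i * P i) (Finset.mem_univ i)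
    rw [← hper i d (c * t), ← Finset.prod_mul_distrib, hc]
    congr 1
    push_cast
    ring
  · intro d hd
    obtain ⟨i, hi⟩ : ∃ i, ¬ (M i : ℤ) ∣ d := by
      by_contra! hall
      apply hd
      push_cast
      refine Finset.prod_dvd_of_coprime (fun i _ j _ hij => ?_) fun i _ => hall i
      rw [Function.onFun, Nat.isCoprime_iff_coprime]
      exact Nat.Coprime.coprime_mul_right (Nat.Coprime.coprime_mul_right_right (hcop hij))
    exact Finset.prod_eq_zero (Finset.mem_univ i) (hsupp i d hi)
  · intro d
    rw [Finset.abs_prod]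
    exact Finset.prod_le_prod (fun _ _ => abs_nonneg _) fun i _ => hbd i d

lemma double_sum_prod_layers_le {p : ι → ℕ} (hp : ∀ i, (p i).Prime)
    (hinj : Function.Injective p) {A γ : ι → ℝ} (hA : ∀ i, 0 ≤ A i) (hγ : ∀ i, 0 ≤ γ i)
    (m : ι → ℕ) {N : ℕ} (hN : 0 < N) :
    ∑ n ∈ Finset.range N, ∑ h ∈ Finset.range N,
      ∏ i, (A i + γ i * ∑ k ∈ Finset.range (m i), layer (p i) k ((n : ℤ) - h)) ≤
      (N : ℝ) ^ 2 * ∏ i, A i + ∏ i, (A i + m i * (γ i / 6 * ((min (p i) N : ℕ) : ℝ) ^ 2)) := by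
  have h1 : ∀ i d, A i + γ i * ∑ k ∈ Finset.range (m i), layer (p i) k d =
      ∑ k ∈ Finset.range (m i + 1), layerTerm (A i) (γ i) (p i) k d := by
    intro i d
    rw [Finset.sum_range_succ', Finset.mul_sum, add_comm]
    rfl
  have h2 : ∀ i, A i + m i * (γ i / 6 * ((min (p i) N : ℕ) : ℝ) ^ 2) =
      ∑ k ∈ Finset.range (m i + 1), layerBound (A i) (γ i) (p i) N k := by
    intro i
    rw [Finset.sum_range_succ']
    simp only [layerBound, Finset.sum_const, Finset.card_range, nsmul_eq_mul]
    rw [add_comm]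
  simp only [h1, h2]
  simp only [Finset.prod_univ_sum]
  rw [Finset.sum_congr rfl fun n _ => Finset.sum_comm, Finset.sum_comm]
  have hmem : (0 : ι → ℕ) ∈ Fintype.piFinset fun i => Finset.range (m i + 1) := by simp
  rw [← Finset.add_sum_erase _ _ hmem]
  refine add_le_add (le_of_eq ?_) ?_
  · simp [layerTerm, sq, mul_assoc]
  · calc _ ≤ ∑ κ ∈ (Fintype.piFinset fun i => Finset.range (m i + 1)).erase 0,
          ∏ i, layerBound (A i) (γ i) (p i) N (κ i) :=
          Finset.sum_le_sum fun κ hκ => (le_abs_self _).trans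
            (abs_double_sum_prod_layerTerm_le hp hinj hA hγ (Finset.ne_of_mem_erase hκ) hN)
      _ ≤ _ := Finset.sum_le_sum_of_subset_of_nonneg (Finset.erase_subset _ _) fun κ _ _ =>
          Finset.prod_nonneg fun i _ => layerBound_nonneg (hA i) (hγ i) _ _ _

end periodic

section assembly

lemma integral_pi_prod {ι : Type*} [Fintype ι] (f : ι → ℝ → ℝ) :
    ∫ σ in (Set.univ.pi fun _ : ι => Set.Ico (0 : ℝ) 1), ∏ j, f j (σ j) =
      ∏ j, ∫ t in Set.Ico (0 : ℝ) 1, f j t := by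
  rw [volume_pi, Measure.restrict_pi_pi]
  exact integral_fintype_prod_eq_prod f

lemma integrableOn_pi_prod {ι : Type*} [Fintype ι] {f : ι → ℝ → ℝ}
    (hf : ∀ j, IntegrableOn (f j) (Set.Ico 0 1)) :
    IntegrableOn (fun σ : ι → ℝ => ∏ j, f j (σ j))
      (Set.univ.pi fun _ : ι => Set.Ico (0 : ℝ) 1) := by
  rw [IntegrableOn, volume_pi, Measure.restrict_pi_pi]
  exact Integrable.fintype_prod hf

lemma integral_sqErr_shift {γ : ℕ → ℝ} {p : ℕ → ℕ} (hp : ∀ j, 2 ≤ p j) (s : ℕ) {N : ℕ}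
    (hN : 0 < N) (m : ℕ → ℕ) (hm : ∀ j, N ≤ p j ^ m j) :
    ∫ σ in (Set.univ.pi fun _ : Fin s => Set.Ico (0 : ℝ) 1),
      sqErr s N γ (fun n j => pshift (p j.val) (radInv (p j.val) n.val) (σ j)) =
    -(∏ j : Fin s, (1 + γ j / 3)) + 1 / (N : ℝ) ^ 2 *
      ∑ n ∈ Finset.range N, ∑ h ∈ Finset.range N, ∏ j : Fin s,
        (1 + γ j / 3 + γ j * ∑ k ∈ Finset.range (m j), layer (p j) k ((n : ℤ) - h) +
          if (n : ℤ) - h = 0 then γ j / (6 * (p j : ℝ) ^ m j) else 0) := by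
  have hN' : (N : ℝ) ≠ 0 := by exact_mod_cast hN.ne'
  have i1 : ∀ n : Fin N, IntegrableOn (fun σ : Fin s → ℝ => ∏ j : Fin s,
      (1 + γ j.val / 2 * (1 - pshift (p j.val) (radInv (p j.val) n.val) (σ j) ^ 2)))
      (Set.univ.pi fun _ : Fin s => Set.Ico (0 : ℝ) 1) := fun n =>
    integrableOn_pi_prod
      (f := fun (j : Fin s) t => 1 + γ j.val / 2 * (1 - pshift (p j.val) (radInv (p j.val) n.val) t ^ 2))
      fun j => integrableOn_comp_pshift (hp j)
        (g := fun x _ => 1 + γ j.val / 2 * (1 - x ^ 2)) (by fun_prop)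
        (M := 1 + |γ j.val| / 2) (fun x hx y _ => by
          refine (abs_add_le _ _).trans ?_
          rw [abs_one, abs_mul, abs_div, abs_two]
          have : |1 - x ^ 2| ≤ 1 := by
            rw [abs_le]; constructor <;> nlinarith [hx.1, hx.2]
          have := mul_le_mul_of_nonneg_left this (by positivity : 0 ≤ |γ j.val| / 2)
          linarith) n n
  have i2 : ∀ n h : Fin N, IntegrableOn (fun σ : Fin s → ℝ => ∏ j : Fin s,
      (1 + γ j.val * min (1 - pshift (p j.val) (radInv (p j.val) n.val) (σ j))
        (1 - pshift (p j.val) (radInv (p j.val) h.val) (σ j))))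
      (Set.univ.pi fun _ : Fin s => Set.Ico (0 : ℝ) 1) := fun n h =>
    integrableOn_pi_prod
      (f := fun (j : Fin s) t => 1 + γ j.val * min (1 - pshift (p j.val) (radInv (p j.val) n.val) t)
        (1 - pshift (p j.val) (radInv (p j.val) h.val) t))
      fun j => integrableOn_comp_pshift (hp j)
        (g := fun x y => 1 + γ j.val * min (1 - x) (1 - y))
        (measurable_const.add (measurable_const.mul
          ((measurable_const.sub measurable_fst).min (measurable_const.sub measurable_snd))))
        (M := 1 + |γ j.val|) (fun x hx y hy => by
          refine (abs_add_le _ _).trans ?_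
          rw [abs_one, abs_mul]
          have : |min (1 - x) (1 - y)| ≤ 1 := by
            rw [abs_of_nonneg (le_min (by linarith [hx.2]) (by linarith [hy.2]))]
            exact (min_le_left _ _).trans (by linarith [hx.1])
          have := mul_le_mul_of_nonneg_left this (abs_nonneg (γ j.val))
          linarith) n h
  have e1 : ∀ n : Fin N, ∫ σ in (Set.univ.pi fun _ : Fin s => Set.Ico (0 : ℝ) 1), ∏ j : Fin s,
      (1 + γ j.val / 2 * (1 - pshift (p j.val) (radInv (p j.val) n.val) (σ j) ^ 2)) =
      ∏ j : Fin s, (1 + γ j / 3) := fun n => by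
    rw [integral_pi_prod
      fun (j : Fin s) t => 1 + γ j.val / 2 * (1 - pshift (p j.val) (radInv (p j.val) n.val) t ^ 2)]
    exact Finset.prod_congr rfl fun j _ => integral_one_add_sq (hp j) _ _
  have e2 : ∀ n h : Fin N, ∫ σ in (Set.univ.pi fun _ : Fin s => Set.Ico (0 : ℝ) 1), ∏ j : Fin s,
      (1 + γ j.val * min (1 - pshift (p j.val) (radInv (p j.val) n.val) (σ j))
        (1 - pshift (p j.val) (radInv (p j.val) h.val) (σ j))) =
      ∏ j : Fin s, (1 + γ j / 3 +
        γ j * ∑ k ∈ Finset.range (m j), layer (p j) k (((n : ℕ) : ℤ) - (h : ℕ)) +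
          if ((n : ℕ) : ℤ) - (h : ℕ) = 0 then γ j / (6 * (p j : ℝ) ^ m j) else 0) := fun n h => by
    rw [integral_pi_prod
      fun (j : Fin s) t => 1 + γ j.val * min (1 - pshift (p j.val) (radInv (p j.val) n.val) t)
        (1 - pshift (p j.val) (radInv (p j.val) h.val) t)]
    refine Finset.prod_congr rfl fun j _ => integral_one_add_min (hp j) _ _ _ _ ?_
    have := hm j
    have h1 := n.isLt
    have h2 := h.isLt
    rw [abs_lt]
    constructor <;> omega
  have hconst : ∫ _ in (Set.univ.pi fun _ : Fin s => Set.Ico (0 : ℝ) 1),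
      ∏ j : Fin s, (1 + γ j.val / 3) = ∏ j : Fin s, (1 + γ j.val / 3) := by
    rw [integral_pi_prod fun (j : Fin s) _ => 1 + γ j.val / 3]
    simp
  have hcint : IntegrableOn (fun _ : Fin s → ℝ => ∏ j : Fin s, (1 + γ j.val / 3))
      (Set.univ.pi fun _ : Fin s => Set.Ico (0 : ℝ) 1) :=
    integrableOn_pi_prod (f := fun (j : Fin s) _ => 1 + γ j.val / 3) fun j => by simp
  have i1' := (integrable_finsetSum Finset.univ fun n _ => i1 n).const_mul (2 / (N : ℝ))
  have i2' := (integrable_finsetSum Finset.univ fun n _ =>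
    integrable_finsetSum Finset.univ fun h _ => i2 n h).const_mul (1 / (N : ℝ) ^ 2)
  simp only [sqErr]
  refine (integral_add (hcint.sub i1') i2').trans ?_
  simp only [Pi.sub_apply]
  rw [integral_sub hcint i1', hconst, integral_const_mul,
    integral_const_mul, integral_finsetSum _ fun n _ => i1 n,
    integral_finsetSum _ fun n _ => integrable_finsetSum Finset.univ fun h _ => i2 n h]
  simp only [integral_finsetSum _ fun h _ => i2 _ h, e1, e2]
  rw [Finset.sum_range]
  simp only [Finset.sum_range, Finset.sum_const, Finset.card_univ, Fintype.card_fin, nsmul_eq_mul]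
  congr 1
  field_simp
  ring

lemma prod_add_smul_le {ι : Type*} [DecidableEq ι] (u : Finset ι) {x y : ι → ℝ}
    (hx : ∀ i, 0 ≤ x i) (hy : ∀ i, 0 ≤ y i) {t : ℝ} (ht0 : 0 ≤ t) (ht1 : t ≤ 1) :
    ∏ i ∈ u, (x i + t * y i) ≤ (1 - t) * ∏ i ∈ u, x i + t * ∏ i ∈ u, (x i + y i) := by
  induction u using Finset.induction_on with
  | empty => simp
  | insert i u hi ih =>
    rw [Finset.prod_insert hi, Finset.prod_insert hi, Finset.prod_insert hi]
    have hXY : ∏ i ∈ u, x i ≤ ∏ i ∈ u, (x i + y i) :=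
      Finset.prod_le_prod (fun i _ => hx i) fun i _ => by linarith [hy i]
    have h1 := mul_le_mul_of_nonneg_left ih (add_nonneg (hx i) (mul_nonneg ht0 (hy i)))
    have h2 : 0 ≤ t * (1 - t) * y i * (∏ i ∈ u, (x i + y i) - ∏ i ∈ u, x i) :=
      mul_nonneg (mul_nonneg (mul_nonneg ht0 (by linarith)) (hy i)) (by linarith)
    nlinarith

lemma sum_layer_zero {p : ℕ} (hp : 2 ≤ p) (m : ℕ) :
    ∑ k ∈ Finset.range m, layer p k 0 = 1 / 6 - 1 / (6 * (p : ℝ) ^ m) := by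
  have := integral_abs_odometer_sub hp m 0 0 (by
    simpa using pow_pos (by omega) m)
  simp only [sub_self, abs_zero, integral_zero, zero_div, sub_zero, if_true, Nat.cast_zero] at this
  linarith

lemma sq_mul_integral_sqErr_shift_le {γ : ℕ → ℝ} (hγ0 : ∀ j, 0 ≤ γ j) {p : ℕ → ℕ}
    (hp : ∀ j, (p j).Prime) (hinj : Function.Injective p) (s : ℕ) {N : ℕ} (hN : 0 < N)
    (m : ℕ → ℕ) (hm : ∀ j, N ≤ p j ^ m j) :
    (N : ℝ) ^ 2 * ∫ σ in (Set.univ.pi fun _ : Fin s => Set.Ico (0 : ℝ) 1),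
      sqErr s N γ (fun n j => pshift (p j.val) (radInv (p j.val) n.val) (σ j)) ≤
    ∏ j : Fin s, (1 + γ j / 3 + m j * (γ j / 6 * ((min (p j) N : ℕ) : ℝ) ^ 2)) +
      ∏ j : Fin s, (1 + γ j) := by
  have hN' : (0 : ℝ) < N := by exact_mod_cast hN
  have hN1 : (1 : ℝ) ≤ N := by exact_mod_cast hN
  rw [integral_sqErr_shift (fun j => (hp j).two_le) s hN m hm]
  set x : ℤ → Fin s → ℝ := fun d j =>
    1 + γ j / 3 + γ j * ∑ k ∈ Finset.range (m j), layer (p j) k d with hx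
  have hle : ∀ n h : ℕ, ∏ j : Fin s, (x ((n : ℤ) - h) j +
      if (n : ℤ) - h = 0 then γ j / (6 * (p j : ℝ) ^ m j) else 0) ≤
      ∏ j, x ((n : ℤ) - h) j + if n = h then 1 / N * ∏ j : Fin s, (1 + γ j) else 0 := by
    intro n h
    rcases eq_or_ne n h with rfl | hnh
    · simp only [sub_self, if_true]
      have hpm : ∀ j, (N : ℝ) ≤ (p j : ℝ) ^ m j := fun j => by exact_mod_cast hm j
      have hq : ∀ j, N / (p j : ℝ) ^ m j ≤ 1 := fun j => div_le_one_of_le₀ (hpm j) (by positivity)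
      have hq' : ∀ j, 1 / (6 * (p j : ℝ) ^ m j) ≤ 1 / 6 := fun j =>
        one_div_le_one_div_of_le (by norm_num) (by linarith [hpm j])
      have hx0 : ∀ j, x 0 j = 1 + γ j / 3 + γ j * (1 / 6 - 1 / (6 * (p j : ℝ) ^ m j)) := fun j => by
        simp only [hx]
        rw [sum_layer_zero (hp j).two_le]
      have hxnn : ∀ j, 0 ≤ x 0 j := fun j => by
        rw [hx0]
        have := mul_nonneg (hγ0 j) (sub_nonneg.2 (hq' j))
        linarith [hγ0 j]
      have hy : ∀ j : Fin s, 0 ≤ γ j / 6 * (N / (p j : ℝ) ^ m j) := fun j =>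
        mul_nonneg (by linarith [hγ0 j]) (by positivity)
      have key := prod_add_smul_le Finset.univ hxnn hy (t := 1 / N) (by positivity)
        ((div_le_one hN').2 hN1)
      have h1 : ∀ j : Fin s, γ j / (6 * (p j : ℝ) ^ m j) =
          1 / N * (γ j / 6 * (N / (p j : ℝ) ^ m j)) := fun j => by
        field_simp
      have h2 : ∏ j, (x 0 j + γ j / 6 * (N / (p j : ℝ) ^ m j)) ≤ ∏ j : Fin s, (1 + γ j) := by
        refine Finset.prod_le_prod (fun j _ => add_nonneg (hxnn j) (hy j)) fun j _ => ?_
        have h3 := mul_le_mul_of_nonneg_left (hq j) (by linarith [hγ0 j] : 0 ≤ γ j / 6)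
        have h4 : 0 ≤ γ j * (1 / (6 * (p j : ℝ) ^ m j)) := mul_nonneg (hγ0 j) (by positivity)
        rw [hx0]
        linarith [hγ0 j]
      simp only [h1]
      have h5 : 0 ≤ 1 / (N : ℝ) * ∏ j, x 0 j :=
        mul_nonneg (by positivity) (Finset.prod_nonneg fun j _ => hxnn j)
      have h6 := mul_le_mul_of_nonneg_left h2 (by positivity : 0 ≤ 1 / (N : ℝ))
      linarith
    · have : (n : ℤ) - h ≠ 0 := by omega
      simp [this, hnh]
  have hsum : ∑ n ∈ Finset.range N, ∑ h ∈ Finset.range N, ∏ j : Fin s, (x ((n : ℤ) - h) j +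
      if (n : ℤ) - h = 0 then γ j / (6 * (p j : ℝ) ^ m j) else 0) ≤
      ∑ n ∈ Finset.range N, ∑ h ∈ Finset.range N, ∏ j, x ((n : ℤ) - h) j +
        ∏ j : Fin s, (1 + γ j) := by
    refine (Finset.sum_le_sum fun n _ => Finset.sum_le_sum fun h _ => hle n h).trans (le_of_eq ?_)
    simp only [Finset.sum_add_distrib]
    congr 1
    have : ∀ n ∈ Finset.range N, (∑ h ∈ Finset.range N,
        if n = h then 1 / (N : ℝ) * ∏ j : Fin s, (1 + γ j) else 0) =
        1 / (N : ℝ) * ∏ j : Fin s, (1 + γ j) := fun n hn => by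
      rw [Finset.sum_ite_eq, if_pos hn]
    rw [Finset.sum_congr rfl this, Finset.sum_const, Finset.card_range, nsmul_eq_mul]
    field_simp
  have hmain := double_sum_prod_layers_le (p := fun j : Fin s => p j) (fun j => hp j)
    (fun i j hij => Fin.ext (hinj hij)) (A := fun j : Fin s => 1 + γ j / 3)
    (γ := fun j : Fin s => γ j) (fun j => by linarith [hγ0 j]) (fun j => hγ0 j)
    (fun j : Fin s => m j) hN
  rw [mul_add, ← mul_assoc, mul_one_div_cancel (by positivity), one_mul]
  linarith

lemma exists_prod_one_add_mul_le_exp {a : ℕ → ℝ} (ha : ∀ j, 0 ≤ a j) (hs : Summable a) {ε : ℝ}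
    (hε : 0 < ε) : ∃ C > 0, ∀ s : ℕ, ∀ L : ℝ, 0 ≤ L →
      ∏ j ∈ Finset.range s, (1 + a j * L) ≤ C * Real.exp (ε * L) := by
  obtain ⟨J, hJ⟩ := ((tendsto_sum_nat_add a).eventually_lt_const (half_pos hε)).exists
  set η := ε / 2 / (J + 1) with hη
  have hη0 : 0 < η := by positivity
  have hJη : J * η ≤ ε / 2 := by
    have : (J + 1) * η = ε / 2 := by rw [hη]; field_simp
    linarith
  have hC : 0 < ∏ j ∈ Finset.range J, (1 + a j / η) := Finset.prod_pos fun j _ => by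
    have := div_nonneg (ha j) hη0.le
    linarith
  refine ⟨_, hC, fun s L hL => ?_⟩
  have hfac : ∀ j, 1 ≤ 1 + a j * L := fun j => by
    have := mul_nonneg (ha j) hL
    linarith
  have hhead : ∏ j ∈ Finset.range J, (1 + a j * L) ≤
      (∏ j ∈ Finset.range J, (1 + a j / η)) * Real.exp (ε / 2 * L) := by
    calc ∏ j ∈ Finset.range J, (1 + a j * L)
        ≤ ∏ j ∈ Finset.range J, ((1 + a j / η) * Real.exp (η * L)) := by
          refine Finset.prod_le_prod (fun j _ => by linarith [hfac j]) fun j _ => ?_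
          have h1 : 0 ≤ a j / η := div_nonneg (ha j) hη0.le
          have h2 := mul_le_mul_of_nonneg_left (Real.add_one_le_exp (η * L))
            (by linarith : 0 ≤ 1 + a j / η)
          have h3 : (1 + a j / η) * (η * L + 1) = 1 + a j * L + a j / η + η * L := by
            field_simp
            ring
          have h4 := mul_nonneg hη0.le hL
          linarith
      _ = (∏ j ∈ Finset.range J, (1 + a j / η)) * Real.exp (J * (η * L)) := by
          rw [Finset.prod_mul_distrib, Finset.prod_const, Finset.card_range, Real.exp_nat_mul]
      _ ≤ _ := by
          refine mul_le_mul_of_nonneg_left (Real.exp_le_exp.2 ?_) hC.le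
          rw [← mul_assoc]
          exact mul_le_mul_of_nonneg_right hJη hL
  have htail : ∏ i ∈ Finset.range s, (1 + a (J + i) * L) ≤ Real.exp (ε / 2 * L) := by
    calc ∏ i ∈ Finset.range s, (1 + a (J + i) * L)
        ≤ ∏ i ∈ Finset.range s, Real.exp (a (i + J) * L) := by
          refine Finset.prod_le_prod (fun i _ => by linarith [hfac (J + i)]) fun i _ => ?_
          rw [add_comm 1, add_comm J]
          exact Real.add_one_le_exp _
      _ = Real.exp ((∑ i ∈ Finset.range s, a (i + J)) * L) := by
          rw [← Real.exp_sum, Finset.sum_mul]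
      _ ≤ _ := by
          gcongr
          exact (((summable_nat_add_iff J).2 hs).sum_le_tsum _ fun i _ => ha _).trans hJ.le
  calc ∏ j ∈ Finset.range s, (1 + a j * L)
      ≤ ∏ j ∈ Finset.range (J + s), (1 + a j * L) :=
        Finset.prod_le_prod_of_subset_of_one_le (Finset.range_mono (Nat.le_add_left s J))
          (fun j _ => by linarith [hfac j]) fun j _ _ => hfac j
    _ = (∏ j ∈ Finset.range J, (1 + a j * L)) * ∏ i ∈ Finset.range s, (1 + a (J + i) * L) :=
        Finset.prod_range_add _ _ _
    _ ≤ ((∏ j ∈ Finset.range J, (1 + a j / η)) * Real.exp (ε / 2 * L)) *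
          Real.exp (ε / 2 * L) :=
        mul_le_mul hhead htail (Finset.prod_nonneg fun i _ => by linarith [hfac (J + i)])
          (by positivity)
    _ = _ := by
        rw [mul_assoc, ← Real.exp_add]
        congr 2
        ring

lemma half_le_log {N : ℕ} (hN : 2 ≤ N) : 1 / 2 ≤ Real.log N := by
  have h1 : Real.log 2 ≤ Real.log N := Real.log_le_log (by norm_num) (by exact_mod_cast hN)
  linarith [Real.log_two_gt_d9]

lemma clog_mul_min_sq_le {p N : ℕ} (hp : 2 ≤ p) (hN : 2 ≤ N) :
    (Nat.clog p N : ℝ) * ((min p N : ℕ) : ℝ) ^ 2 ≤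
      2 * ((p : ℝ) ^ 2 / Real.log p * Real.log N) := by
  have hlp : 0 < Real.log p := Real.log_pos (by exact_mod_cast hp)
  have hlN := half_le_log hN
  have hN0 : (0 : ℝ) < N := by exact_mod_cast (by omega : 0 < N)
  have hp0 : (0 : ℝ) < p := by exact_mod_cast (by omega : 0 < p)
  rw [div_mul_eq_mul_div, mul_div_assoc', le_div_iff₀ hlp]
  rcases le_or_gt p N with h | h
  · rw [min_eq_left h]
    have h1 : Real.log p ≤ Real.log N := Real.log_le_log hp0 (by exact_mod_cast h)
    have h2 : (Nat.clog p N : ℝ) * Real.log p ≤ 2 * Real.log N := by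
      have h3 := Nat.pow_pred_clog_lt_self (b := p) (by omega) (x := N) (by omega)
      obtain ⟨k, hk⟩ := Nat.exists_eq_succ_of_ne_zero (Nat.clog_pos (b := p) (by omega) hN).ne'
      rw [hk] at h3 ⊢
      have h4 : Real.log ((p : ℝ) ^ k) ≤ Real.log N :=
        Real.log_le_log (by positivity) (by exact_mod_cast h3.le)
      rw [Real.log_pow] at h4
      push_cast
      linarith
    have := mul_le_mul_of_nonneg_left h2 (sq_nonneg (p : ℝ))
    linarith
  · rw [min_eq_right h.le]
    have h1 : (Nat.clog p N : ℝ) ≤ 1 := by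
      exact_mod_cast (Nat.clog_le_iff_le_pow (by omega)).2 (by simpa using h.le)
    have h2 : Real.log p ≤ Real.log N + (p / N - 1) := by
      have := Real.log_le_sub_one_of_pos (div_pos hp0 hN0)
      rw [Real.log_div hp0.ne' hN0.ne'] at this
      linarith
    have h3 : (1 : ℝ) ≤ p / N := by
      rw [le_div_iff₀ hN0, one_mul]
      exact_mod_cast h.le
    set t : ℝ := p / N with ht
    have hpt : (p : ℝ) = t * N := by rw [ht]; field_simp
    have h4 : Real.log p ≤ 2 * (t ^ 2 * Real.log N) := by
      nlinarith [sq_nonneg (t - 1), mul_nonneg (sub_nonneg.2 hlN) (sq_nonneg t),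
        mul_nonneg (by linarith : 0 ≤ Real.log N) (by nlinarith : 0 ≤ t ^ 2 - 1)]
    calc (Nat.clog p N : ℝ) * (N : ℝ) ^ 2 * Real.log p
        ≤ 1 * (N : ℝ) ^ 2 * (2 * (t ^ 2 * Real.log N)) := by gcongr
      _ = 2 * ((p : ℝ) ^ 2 * Real.log N) := by rw [hpt]; ring

end assembly

/-- dimension-independent tractability bound for the root mean square
worst-case error of shifted Halton sequences. -/
theorem rms_error_shifted_halton_tractable
    (γ : ℕ → ℝ) (hγpos : ∀ j, 0 < γ j) (hγ1 : γ 0 ≤ 1) (hγmon : Antitone γ)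
    (p : ℕ → ℕ) (hp : ∀ j, (p j).Prime) (hinj : Function.Injective p)
    (hsum : Summable fun j => γ j * (p j : ℝ) ^ 2 / Real.log (p j)) :
    ∀ δ > (0 : ℝ), ∃ C > (0 : ℝ), ∀ s N : ℕ, 2 ≤ N →
      Real.sqrt (∫ σ in (Set.univ.pi fun _ : Fin s => Set.Ico (0 : ℝ) 1),
          sqErr s N γ fun n j => pshift (p j.val) (radInv (p j.val) n.val) (σ j)) ≤
        C / (N : ℝ) ^ ((1 : ℝ) - δ) := by
  intro δ hδ
  set a : ℕ → ℝ := fun j => γ j * (p j : ℝ) ^ 2 / Real.log (p j) with ha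
  have hlog : ∀ j, 0 < Real.log (p j) := fun j =>
    Real.log_pos (by exact_mod_cast (hp j).one_lt)
  have ha0 : ∀ j, 0 ≤ a j := fun j =>
    div_nonneg (mul_nonneg (hγpos j).le (sq_nonneg _)) (hlog j).le
  have hγa : ∀ j, γ j ≤ a j := fun j => by
    have h1 : (1 : ℝ) ≤ p j := by exact_mod_cast (hp j).one_lt.le
    have h2 : Real.log (p j) ≤ (p j : ℝ) ^ 2 := by
      have := Real.log_le_sub_one_of_pos (by linarith : (0 : ℝ) < p j)
      nlinarith
    simp only [ha]
    rw [le_div_iff₀ (hlog j)]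
    exact mul_le_mul_of_nonneg_left h2 (hγpos j).le
  have hγsum : Summable γ := hsum.of_nonneg_of_le (fun j => (hγpos j).le) hγa
  obtain ⟨C, hC, hbound⟩ := exists_prod_one_add_mul_le_exp ha0 hsum (by positivity : 0 < 2 * δ)
  set E := Real.exp (∑' j, γ j) with hE
  have hE0 : 0 < E := Real.exp_pos _
  refine ⟨Real.sqrt (C + E), Real.sqrt_pos.2 (by linarith), fun s N hN => ?_⟩
  have hN0 : (0 : ℝ) < N := by exact_mod_cast (by omega : 0 < N)
  have hN1 : (1 : ℝ) ≤ N := by exact_mod_cast (by omega : 1 ≤ N)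
  have hL := half_le_log hN
  have hmain := sq_mul_integral_sqErr_shift_le (fun j => (hγpos j).le) hp hinj s (N := N)
    (by omega) (fun j => Nat.clog (p j) N) fun j => Nat.le_pow_clog (hp j).one_lt N
  have h1 : ∏ j : Fin s, (1 + γ j / 3 +
      (Nat.clog (p j) N : ℝ) * (γ j / 6 * ((min (p j) N : ℕ) : ℝ) ^ 2)) ≤
      C * (N : ℝ) ^ (2 * δ) := by
    calc _ ≤ ∏ j : Fin s, (1 + a j * Real.log N) := by
          refine Finset.prod_le_prod (fun j _ => ?_) fun j _ => ?_
          · have := (hγpos j).le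
            positivity
          · have h2 := mul_le_mul_of_nonneg_left (clog_mul_min_sq_le (hp j).two_le hN)
              (by linarith [hγpos j] : 0 ≤ γ j / 6)
            have h3 : γ j / 6 * (2 * ((p j : ℝ) ^ 2 / Real.log (p j) * Real.log N)) =
                a j * Real.log N / 3 := by
              simp only [ha]; ring
            have h4 := mul_le_mul_of_nonneg_left hL (ha0 j)
            have h5 := hγa j
            linarith
      _ = ∏ j ∈ Finset.range s, (1 + a j * Real.log N) :=
          Fin.prod_univ_eq_prod_range (fun j => 1 + a j * Real.log N) s
      _ ≤ C * Real.exp (2 * δ * Real.log N) := hbound s _ (by linarith)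
      _ = _ := by rw [Real.rpow_def_of_pos hN0, mul_comm (2 * δ)]
  have h2 : ∏ j : Fin s, (1 + γ j) ≤ E := by
    rw [Fin.prod_univ_eq_prod_range (fun j => 1 + γ j) s]
    calc ∏ j ∈ Finset.range s, (1 + γ j) ≤ ∏ j ∈ Finset.range s, Real.exp (γ j) :=
          Finset.prod_le_prod (fun j _ => by linarith [hγpos j]) fun j _ => by
            rw [add_comm]; exact Real.add_one_le_exp _
      _ = Real.exp (∑ j ∈ Finset.range s, γ j) := (Real.exp_sum _ _).symm
      _ ≤ E := Real.exp_le_exp.2 (hγsum.sum_le_tsum _ fun j _ => (hγpos j).le)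
  have h3 : (1 : ℝ) ≤ (N : ℝ) ^ (2 * δ) := Real.one_le_rpow hN1 (by positivity)
  have hpow : (N : ℝ) ^ 2 = (N : ℝ) ^ (2 * δ) * ((N : ℝ) ^ (1 - δ)) ^ 2 := by
    rw [← Real.rpow_natCast ((N : ℝ) ^ (1 - δ)), ← Real.rpow_mul hN0.le, ← Real.rpow_add hN0,
      ← Real.rpow_natCast (N : ℝ)]
    congr 1
    push_cast
    ring
  refine Real.sqrt_le_iff.2 ⟨by positivity, ?_⟩
  rw [div_pow, Real.sq_sqrt (by linarith), le_div_iff₀ (by positivity)]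
  refine le_of_mul_le_mul_left ?_ (by linarith : (0 : ℝ) < (N : ℝ) ^ (2 * δ))
  have h4 := mul_le_mul_of_nonneg_left h3 hE0.le
  rw [hpow] at hmain
  linarith
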